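/- arXiv:2109.05405 — 10 statements merged into one kernel-verified Lean document; each statement's English description precedes it below -/
import Mathlib

section
/- Let A_1, A_2, A_3, A_4 be n×n quaternion Hermitian matrices and let X be an n×n quaternion Hermitian positive semidefinite matrix of rank r ≥ 1. Then there exist vectors x_1, …, x_r ∈ ℍⁿ such that X = Σ_{i=1}^r x_i x_iᴴ and x_iᴴ A_k x_i = (A_k • X)/r for every i = 1, …, r and every k = 1, 2, 3, 4. -/
open Matrix Quaternion BigOperators

/-- The quadratic form `xᴴ A x` of a quaternion matrix. -/
noncomputable def qform {n : ℕ} (A : Matrix (Fin n) (Fin n) ℍ[ℝ]) (x : Fin n → ℍ[ℝ]) : ℍ[ℝ] :=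
  star x ⬝ᵥ A.mulVec x

/-- The inner product `A • B = Re (tr (Aᴴ B))` of quaternion matrices. -/
noncomputable def qdot {n : ℕ} (A B : Matrix (Fin n) (Fin n) ℍ[ℝ]) : ℝ :=
  (Matrix.trace (Aᴴ * B)).re

/-- A quaternion matrix is Hermitian positive semidefinite:
it is Hermitian and `xᴴ X x ≥ 0` for all `x`. -/
def qPSD {n : ℕ} (X : Matrix (Fin n) (Fin n) ℍ[ℝ]) : Prop :=
  X.IsHermitian ∧ ∀ x : Fin n → ℍ[ℝ], 0 ≤ (star x ⬝ᵥ X.mulVec x).re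

/-- `X` can be written as a sum of `r` quaternion rank-one outer products. -/
def qDecomp {n : ℕ} (X : Matrix (Fin n) (Fin n) ℍ[ℝ]) (r : ℕ) : Prop :=
  ∃ v : Fin r → (Fin n → ℍ[ℝ]), X = ∑ i, vecMulVec (v i) (star (v i))

/-- `X` has rank `r`: `r` is the least number of rank-one terms summing to `X`. -/
def qRank {n : ℕ} (X : Matrix (Fin n) (Fin n) ℍ[ℝ]) (r : ℕ) : Prop :=
  qDecomp X r ∧ ∀ s : ℕ, qDecomp X s → r ≤ s

/-- If any two elements `a`, `b` of `S` can be replaced by elements of `S` with the same sum, the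
first of which has a prescribed `L`-value on the segment from `L b` to `L a`, then any nonempty
finite family in `S` can be replaced by one with the same sum whose first member has the mean
`L`-value. -/
lemma exists_sum_eq_and_map_zero_eq_mean {E F : Type*} [AddCommGroup E] [Module ℝ E]
    [AddCommGroup F] [Module ℝ F] (L : E →ₗ[ℝ] F) (S : Set E)
    (hS : ∀ a ∈ S, ∀ b ∈ S, ∀ t : ℝ, 0 ≤ t → t ≤ 1 →
      ∃ a' ∈ S, ∃ b' ∈ S, a' + b' = a + b ∧ L a' = t • L a + (1 - t) • L b)
    (m : ℕ) (x : Fin (m + 1) → E) (hx : ∀ i, x i ∈ S) :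
    ∃ y : Fin (m + 1) → E, (∀ i, y i ∈ S) ∧ ∑ i, y i = ∑ i, x i ∧
      L (y 0) = ((m : ℝ) + 1)⁻¹ • L (∑ i, x i) := by
  induction m with
  | zero => exact ⟨x, hx, rfl, by simp⟩
  | succ m ih =>
    obtain ⟨w, hwS, hw, hw0⟩ := ih (fun i => x i.succ) fun i => hx _
    have hm : (0 : ℝ) < (m : ℝ) + 1 := by positivity
    obtain ⟨a, ha, b, hb, hab, hLa⟩ := hS (x 0) (hx 0) (w 0) (hwS 0) ((m : ℝ) + 1 + 1)⁻¹
      (by positivity) (inv_le_one_of_one_le₀ (by linarith))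
    refine ⟨Fin.cons a (Fin.cons b fun i => w i.succ), ?_, ?_, ?_⟩
    · intro i
      refine Fin.cases ha (fun j => Fin.cases hb (fun k => ?_) j) i
      exact hwS _
    · rw [Fin.sum_univ_succ x, ← hw, Fin.sum_univ_succ w, ← add_assoc, ← hab]
      simp [Fin.sum_univ_succ, add_assoc]
    · rw [Fin.sum_univ_succ x, map_add, Fin.cons_zero, hLa, hw0, smul_smul, smul_add]
      have h : (1 - ((m : ℝ) + 1 + 1)⁻¹) * ((m : ℝ) + 1)⁻¹ = ((m : ℝ) + 1 + 1)⁻¹ := by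
        field_simp
        ring
      rw [h, Nat.cast_succ]

/-- Under the exchange property of `exists_sum_eq_and_map_zero_eq_mean`, a finite family in `S` can
be replaced by one with the same sum all of whose members have the mean `L`-value. -/
lemma exists_sum_eq_and_map_eq_mean {E F : Type*} [AddCommGroup E] [Module ℝ E]
    [AddCommGroup F] [Module ℝ F] (L : E →ₗ[ℝ] F) (S : Set E)
    (hS : ∀ a ∈ S, ∀ b ∈ S, ∀ t : ℝ, 0 ≤ t → t ≤ 1 →
      ∃ a' ∈ S, ∃ b' ∈ S, a' + b' = a + b ∧ L a' = t • L a + (1 - t) • L b)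
    (m : ℕ) (x : Fin m → E) (hx : ∀ i, x i ∈ S) :
    ∃ y : Fin m → E, (∀ i, y i ∈ S) ∧ ∑ i, y i = ∑ i, x i ∧
      ∀ i, L (y i) = (m : ℝ)⁻¹ • L (∑ i, x i) := by
  induction m with
  | zero => exact ⟨x, hx, rfl, fun i => i.elim0⟩
  | succ m ih =>
    obtain ⟨w, hwS, hw, hw0⟩ := exists_sum_eq_and_map_zero_eq_mean L S hS m x hx
    obtain ⟨y, hyS, hy, hyL⟩ := ih (fun i => w i.succ) fun i => hwS _
    refine ⟨Fin.cons (w 0) y, fun i => Fin.cases (hwS 0) hyS i, ?_, fun i => ?_⟩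
    · rw [← hw, Fin.sum_univ_succ w, ← hy]
      simp [Fin.sum_univ_succ]
    · refine Fin.cases ?_ (fun j => ?_) i
      · simpa using hw0
      · have hm : (m : ℝ) ≠ 0 := by
          have : 0 < m := j.pos
          positivity
        have hsum : L (∑ i, w (Fin.succ i)) = L (∑ i, x i) - L (w 0) := by
          rw [← hw, Fin.sum_univ_succ w, map_add]
          abel
        rw [Fin.cons_succ, hyL, hsum, hw0]
        push_cast
        match_scalars
        field_simp
        ring

/-- The real-linear map `q ↦ v q̄ wᴴ + w q vᴴ`. -/
noncomputable def quaternionCross {n : ℕ} (v w : Fin n → ℍ[ℝ]) :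
    ℍ[ℝ] →ₗ[ℝ] Matrix (Fin n) (Fin n) ℍ[ℝ] where
  toFun q := Matrix.of fun i j => v i * star q * star (w j) + w i * q * star (v j)
  map_add' p q := by
    ext1 i j
    simp only [Matrix.of_apply, Matrix.add_apply, star_add, mul_add, add_mul]
    abel
  map_smul' c q := by
    ext1 i j
    simp only [Matrix.of_apply, Matrix.smul_apply, Quaternion.star_smul, mul_smul_comm,
      smul_mul_assoc, smul_add, RingHom.id_apply]

lemma quaternion_mul_star_of_norm_eq_one {q : ℍ[ℝ]} (hq : ‖q‖ = 1) : q * star q = 1 := by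
  rw [Quaternion.self_mul_star, Quaternion.normSq_eq_norm_mul_self, hq]
  simp

lemma vecMulVec_rotate {n : ℕ} (v w : Fin n → ℍ[ℝ]) (c s : ℝ) {q : ℍ[ℝ]} (hq : ‖q‖ = 1) :
    vecMulVec (fun i => c • v i + s • (w i * q)) (star fun i => c • v i + s • (w i * q)) =
      c ^ 2 • vecMulVec v (star v) + s ^ 2 • vecMulVec w (star w) +
        (c * s) • quaternionCross v w q := by
  ext1 i j
  have h : w i * q * star q * star (w j) = w i * star (w j) := by
    rw [mul_assoc (w i), quaternion_mul_star_of_norm_eq_one hq, mul_one]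
  simp only [quaternionCross, LinearMap.coe_mk, AddHom.coe_mk, Matrix.add_apply, Matrix.smul_apply,
    Matrix.of_apply, vecMulVec_apply, Pi.star_apply, star_add, Quaternion.star_smul, star_mul,
    mul_add, add_mul, mul_smul_comm, smul_mul_assoc, h, ← mul_assoc]
  module

/-- Two rank-one matrices can be rotated into two others with the same sum so that four real linear
functionals take prescribed values on the segment at the first one. -/
lemma exists_vecMulVec_exchange {n : ℕ}
    (L : Matrix (Fin n) (Fin n) ℍ[ℝ] →ₗ[ℝ] (Fin 4 → ℝ)) (v w : Fin n → ℍ[ℝ]) (t : ℝ)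
    (ht0 : 0 ≤ t) (ht1 : t ≤ 1) :
    ∃ a b : Fin n → ℍ[ℝ],
      vecMulVec a (star a) + vecMulVec b (star b) =
        vecMulVec v (star v) + vecMulVec w (star w) ∧
      L (vecMulVec a (star a)) =
        t • L (vecMulVec v (star v)) + (1 - t) • L (vecMulVec w (star w)) := by
  set d := L (vecMulVec v (star v)) - L (vecMulVec w (star w)) with hd
  let l : ℍ[ℝ] →ₗ[ℝ] (Fin 4 → ℝ) := L ∘ₗ quaternionCross v w
  obtain ⟨c, s, q, hcs, hq, h⟩ : ∃ (c s : ℝ) (q : ℍ[ℝ]), c ^ 2 + s ^ 2 = 1 ∧ ‖q‖ = 1 ∧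
      (c * s) • l q = (t - c ^ 2) • d := by
    by_cases hl : Function.Injective l
    · have hsurj : Function.Surjective l :=
        (LinearMap.injective_iff_surjective_of_finrank_eq_finrank
          (by rw [Quaternion.finrank_eq_four]; simp)).1 hl
      obtain ⟨u, hu⟩ := hsurj d
      by_cases hu0 : u = 0
      · refine ⟨1, 0, 1, by simp, by simp, ?_⟩
        rw [← hu, hu0]
        simp
      · have hun : ‖u‖ ≠ 0 := norm_ne_zero_iff.2 hu0
        have hcont : ContinuousOn
            (fun θ : ℝ => (t - Real.cos θ ^ 2) * ‖u‖ - Real.cos θ * Real.sin θ)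
            (Set.Icc 0 (Real.pi / 2)) := by fun_prop
        obtain ⟨θ, -, hθ⟩ := intermediate_value_Icc (by positivity) hcont
          (show (0 : ℝ) ∈ _ by
            constructor
            · simpa using mul_nonpos_of_nonpos_of_nonneg (sub_nonpos.2 ht1) (norm_nonneg u)
            · simpa using mul_nonneg ht0 (norm_nonneg u))
        refine ⟨Real.cos θ, Real.sin θ, ‖u‖⁻¹ • u, Real.cos_sq_add_sin_sq θ, ?_, ?_⟩
        · rw [norm_smul, norm_inv, norm_norm, inv_mul_cancel₀ hun]
        · rw [map_smul, hu, smul_smul]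
          congr 1
          field_simp
          linarith
    · obtain ⟨u, hu, hu0⟩ : ∃ u, l u = 0 ∧ u ≠ 0 := by
        simpa [injective_iff_map_eq_zero] using hl
      have hun : ‖u‖ ≠ 0 := norm_ne_zero_iff.2 hu0
      refine ⟨√t, √(1 - t), ‖u‖⁻¹ • u, ?_, ?_, ?_⟩
      · rw [Real.sq_sqrt ht0, Real.sq_sqrt (sub_nonneg.2 ht1)]
        ring
      · rw [norm_smul, norm_inv, norm_norm, inv_mul_cancel₀ hun]
      · rw [map_smul, hu, Real.sq_sqrt ht0]
        simp
  have hcross : quaternionCross w v (-star q) = -quaternionCross v w q := by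
    ext1 i j
    simp [quaternionCross, add_comm]
  refine ⟨fun i => c • v i + s • (w i * q), fun i => c • w i + s • (v i * -star q), ?_, ?_⟩
  · rw [vecMulVec_rotate v w c s hq, vecMulVec_rotate w v c s (by simpa using hq), hcross]
    have hs : s ^ 2 = 1 - c ^ 2 := by linarith
    rw [hs]
    module
  · rw [vecMulVec_rotate v w c s hq, map_add, map_add, map_smul, map_smul, map_smul]
    have h' : (c * s) • L (quaternionCross v w q) = (t - c ^ 2) • d := h
    have hs : s ^ 2 = 1 - c ^ 2 := by linarith
    rw [h', hs, hd]
    module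

/-- The real-linear functional `qdot A`. -/
noncomputable def qdotLinear {n : ℕ} (A : Matrix (Fin n) (Fin n) ℍ[ℝ]) :
    Matrix (Fin n) (Fin n) ℍ[ℝ] →ₗ[ℝ] ℝ where
  toFun := qdot A
  map_add' M N := by simp [qdot, mul_add]
  map_smul' c M := by simp [qdot]

lemma quaternion_re_mul_comm (a b : ℍ[ℝ]) : (a * b).re = (b * a).re := by
  simp only [Quaternion.re_mul]
  ring

lemma quaternion_re_sum {ι : Type*} (s : Finset ι) (f : ι → ℍ[ℝ]) :
    (∑ i ∈ s, f i).re = ∑ i ∈ s, (f i).re :=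
  map_sum (QuaternionAlgebra.reₗ (R := ℝ) (-1) 0 (-1)) f s

lemma qform_eq_qdot_vecMulVec {n : ℕ} {A : Matrix (Fin n) (Fin n) ℍ[ℝ]} (hA : A.IsHermitian)
    (x : Fin n → ℍ[ℝ]) : qform A x = (qdot A (vecMulVec x (star x)) : ℍ[ℝ]) := by
  have hstar : star (qform A x) = qform A x := by
    rw [qform, ← Matrix.star_dotProduct_star, star_star, Matrix.star_mulVec, hA.eq,
      Matrix.dotProduct_mulVec]
  have hre : (qform A x).re = qdot A (vecMulVec x (star x)) := by
    rw [qform, qdot, hA.eq, Matrix.mul_vecMulVec, Matrix.trace_vecMulVec]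
    simp only [dotProduct, quaternion_re_sum]
    exact Finset.sum_congr rfl fun i _ => quaternion_re_mul_comm _ _
  rw [← hre]
  exact Quaternion.star_eq_self.1 hstar

/-- Quaternion Hermitian matrix rank-one decomposition with the equal inner
product property for four matrices. -/
theorem quaternion_rank_one_decomposition_four {n r : ℕ} (hr : 1 ≤ r)
    (A : Fin 4 → Matrix (Fin n) (Fin n) ℍ[ℝ]) (hA : ∀ k, (A k).IsHermitian)
    (X : Matrix (Fin n) (Fin n) ℍ[ℝ]) (hX : qPSD X) (hrank : qRank X r) :
    ∃ x : Fin r → (Fin n → ℍ[ℝ]),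
      X = ∑ i, vecMulVec (x i) (star (x i)) ∧
      ∀ (i : Fin r) (k : Fin 4),
        qform (A k) (x i) = ((qdot (A k) X / r : ℝ) : ℍ[ℝ]) := by
  obtain ⟨v, hv⟩ := hrank.1
  let L : Matrix (Fin n) (Fin n) ℍ[ℝ] →ₗ[ℝ] (Fin 4 → ℝ) :=
    LinearMap.pi fun k => qdotLinear (A k)
  obtain ⟨y, hyS, hy, hyL⟩ := exists_sum_eq_and_map_eq_mean L
    (Set.range fun x : Fin n → ℍ[ℝ] => vecMulVec x (star x))
    (by
      rintro _ ⟨a, rfl⟩ _ ⟨b, rfl⟩ t ht0 ht1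
      obtain ⟨a', b', hab, hL⟩ := exists_vecMulVec_exchange L a b t ht0 ht1
      exact ⟨_, ⟨a', rfl⟩, _, ⟨b', rfl⟩, hab, hL⟩)
    r (fun i => vecMulVec (v i) (star (v i))) fun i => ⟨v i, rfl⟩
  choose x hx using hyS
  refine ⟨x, ?_, fun i k => ?_⟩
  · rw [hv, ← hy]
    exact Finset.sum_congr rfl fun i _ => (hx i).symm
  · have h := congrFun (hyL i) k
    rw [← hv, ← hx i] at h
    have h' : qdot (A k) (vecMulVec (x i) (star (x i))) = (r : ℝ)⁻¹ * qdot (A k) X := h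
    rw [qform_eq_qdot_vecMulVec (hA k), h', div_eq_inv_mul]
end

section
/- Let A_1, …, A_5 be n×n quaternion Hermitian matrices. Then the set { (xᴴA_1x, xᴴA_2x, xᴴA_3x, xᴴA_4x, xᴴA_5x) : x ∈ ℍⁿ } is a convex subset of ℝ⁵. -/
open Matrix Quaternion BigOperators

/-- A positive semidefinite `2 × 2` quaternion Hermitian matrix of determinant zero is an outer
product. -/
lemma exists_normSq_eq_and_mul_star_eq {a b : ℝ} (ha : 0 ≤ a) (hb : 0 ≤ b) {q : ℍ[ℝ]}
    (h : a * b = normSq q) :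
    ∃ α β : ℍ[ℝ], normSq α = a ∧ normSq β = b ∧ β * star α = q := by
  rcases ha.eq_or_lt with rfl | ha
  · have hq : q = 0 := by
      rw [zero_mul] at h
      exact normSq_eq_zero.mp h.symm
    refine ⟨0, ((√b : ℝ) : ℍ[ℝ]), by simp, ?_, by simp [hq]⟩
    rw [normSq_coe, Real.sq_sqrt hb]
  · have hs : √a ≠ 0 := (Real.sqrt_pos.mpr ha).ne'
    refine ⟨((√a : ℝ) : ℍ[ℝ]), q * (((√a)⁻¹ : ℝ) : ℍ[ℝ]), ?_, ?_, ?_⟩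
    · rw [normSq_coe, Real.sq_sqrt ha.le]
    · rw [map_mul, normSq_coe, inv_pow, Real.sq_sqrt ha.le, ← h]
      field_simp
    · rw [star_coe, mul_assoc, ← coe_mul, inv_mul_cancel₀ hs, coe_one, mul_one]

/-- A line through a diagonal positive semidefinite `2 × 2` matrix contains a positive semidefinite
matrix of determinant zero. Here `(a, b, c)` is the direction of the line, with `c` the squared norm
of its off-diagonal entry. -/
lemma exists_nonneg_mul_eq_sq_mul {s t a b c : ℝ} (hs : 0 ≤ s) (ht : 0 ≤ t) (hc : 0 ≤ c)
    (h : a ≠ 0 ∨ b ≠ 0 ∨ c ≠ 0) :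
    ∃ r : ℝ, 0 ≤ s + r * a ∧ 0 ≤ t + r * b ∧ (s + r * a) * (t + r * b) = r ^ 2 * c := by
  obtain ⟨S, hSa, hSb, hS⟩ : ∃ S : ℝ, 0 ≤ s + S * a ∧ 0 ≤ t + S * b ∧
      (s + S * a) * (t + S * b) ≤ S ^ 2 * c := by
    have of_left (ha : a ≠ 0) (hb : 0 ≤ t + -s / a * b) : ∃ S : ℝ, 0 ≤ s + S * a ∧
        0 ≤ t + S * b ∧ (s + S * a) * (t + S * b) ≤ S ^ 2 * c := by
      have h0 : s + -s / a * a = 0 := by field_simp; ring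
      exact ⟨-s / a, h0.ge, hb, by rw [h0, zero_mul]; positivity⟩
    have of_right (hb : b ≠ 0) (ha : 0 ≤ s + -t / b * a) : ∃ S : ℝ, 0 ≤ s + S * a ∧
        0 ≤ t + S * b ∧ (s + S * a) * (t + S * b) ≤ S ^ 2 * c := by
      have h0 : t + -t / b * b = 0 := by field_simp; ring
      exact ⟨-t / b, ha, h0.ge, by rw [h0, mul_zero]; positivity⟩
    by_cases ha : a = 0
    · by_cases hb : b = 0
      · have hc' : c ≠ 0 := by tauto
        refine ⟨√(s * t / c), by simpa [ha], by simpa [hb], ?_⟩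
        rw [Real.sq_sqrt (by positivity), ha, hb]
        field_simp
        simp
      · exact of_right hb (by simpa [ha])
    · rcases le_or_gt 0 (t + -s / a * b) with hb | hb
      · exact of_left ha hb
      · have hba : t < s * (b / a) := by
          have : -s / a * b = -(s * (b / a)) := by ring
          linarith
        have hpos : 0 < b / a := by
          by_contra! hle
          nlinarith [mul_nonneg hs (neg_nonneg.mpr hle)]
        have hb' : b ≠ 0 := by
          rintro rfl
          simp at hpos
        refine of_right hb' ?_
        have h1 : s + -t / b * a = (s * (b / a) - t) / (b / a) := by
          field_simp
          ring
        rw [h1]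
        exact div_nonneg (by linarith) hpos.le
  have hcont : ContinuousOn
      (fun r : ℝ => (s + r * S * a) * (t + r * S * b) - (r * S) ^ 2 * c) (Set.Icc 0 1) := by
    fun_prop
  obtain ⟨r, ⟨hr0, hr1⟩, hr⟩ := intermediate_value_Icc' zero_le_one hcont
    (show (0 : ℝ) ∈ Set.Icc _ _ from ⟨by simpa using hS, by simpa using mul_nonneg hs ht⟩)
  refine ⟨r * S, ?_, ?_, sub_eq_zero.mp hr⟩
  · nlinarith [mul_nonneg hr0 hSa, mul_nonneg (sub_nonneg.mpr hr1) hs]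
  · nlinarith [mul_nonneg hr0 hSb, mul_nonneg (sub_nonneg.mpr hr1) ht]

lemma star_dotProduct_mulVec_comm {n : ℕ} {A : Matrix (Fin n) (Fin n) ℍ[ℝ]} (hA : A.IsHermitian)
    (x y : Fin n → ℍ[ℝ]) : star x ⬝ᵥ A *ᵥ y = star (star y ⬝ᵥ A *ᵥ x) := by
  rw [star_dotProduct, star_mulVec, hA.eq, ← dotProduct_mulVec]

lemma coe_re_qform {n : ℕ} {A : Matrix (Fin n) (Fin n) ℍ[ℝ]} (hA : A.IsHermitian)
    (x : Fin n → ℍ[ℝ]) : ((qform A x).re : ℍ[ℝ]) = qform A x := by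
  have h : star (qform A x) = qform A x :=
    (star_dotProduct_mulVec_comm hA x x).symm
  exact (star_eq_self.mp h).symm

/-- The form `xᴴ A x` on the right span of two vectors. -/
lemma re_qform_mul_add_mul {n : ℕ} {A : Matrix (Fin n) (Fin n) ℍ[ℝ]} (hA : A.IsHermitian)
    (u v : Fin n → ℍ[ℝ]) (α β : ℍ[ℝ]) :
    (qform A (fun i => u i * α + v i * β)).re =
      normSq α * (qform A u).re + normSq β * (qform A v).re +
        2 * ((star u ⬝ᵥ A *ᵥ v) * (β * star α)).re := by
  have hexpand : qform A (fun i => u i * α + v i * β) =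
      star α * qform A u * α + star β * qform A v * β +
        (star α * (star u ⬝ᵥ A *ᵥ v) * β + star β * (star v ⬝ᵥ A *ᵥ u) * α) := by
    simp only [qform, dotProduct, mulVec, Pi.star_apply, star_add, star_mul, Finset.mul_sum,
      Finset.sum_mul, ← Finset.sum_add_distrib]
    refine Finset.sum_congr rfl fun i _ => Finset.sum_congr rfl fun j _ => ?_
    noncomm_ring
  rw [hexpand, star_dotProduct_mulVec_comm hA v u, ← coe_re_qform hA u, ← coe_re_qform hA v]
  simp only [re_add, re_mul, imI_mul, imJ_mul, imK_mul, re_star, imI_star, imJ_star, imK_star,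
    re_coe, imI_coe, imJ_coe, imK_coe, normSq_def']
  ring

/-- The joint numerical range (without the unit-sphere restriction) of five
quaternion Hermitian matrices is a convex subset of ℝ⁵. -/
theorem joint_numerical_range_five_convex {n : ℕ}
    (A : Fin 5 → Matrix (Fin n) (Fin n) ℍ[ℝ]) (hA : ∀ k, (A k).IsHermitian) :
    Convex ℝ {y : Fin 5 → ℝ |
      ∃ x : Fin n → ℍ[ℝ], ∀ k, ((y k : ℝ) : ℍ[ℝ]) = qform (A k) x} := by
  rintro y ⟨u, hu⟩ z ⟨v, hv⟩ s t hs ht -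
  let L : ℝ × ℝ × ℍ[ℝ] →ₗ[ℝ] (Fin 5 → ℝ) :=
    { toFun := fun p k => p.1 * y k + p.2.1 * z k + 2 * ((star u ⬝ᵥ A k *ᵥ v) * p.2.2).re
      map_add' := fun p p' => by
        ext k
        simp only [Prod.fst_add, Prod.snd_add, mul_add, re_add, Pi.add_apply]
        ring
      map_smul' := fun c p => by
        ext k
        simp only [Prod.smul_fst, Prod.smul_snd, mul_smul_comm, re_smul, smul_eq_mul,
          Pi.smul_apply, RingHom.id_apply]
        ring }
  have hker : LinearMap.ker L ≠ ⊥ := by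
    refine LinearMap.ker_ne_bot_of_finrank_lt ?_
    simp [Quaternion.finrank_eq_four]
  obtain ⟨⟨a, b, q⟩, hmem, hne⟩ := (Submodule.ne_bot_iff _).mp hker
  have hL (k : Fin 5) : a * y k + b * z k + 2 * ((star u ⬝ᵥ A k *ᵥ v) * q).re = 0 :=
    congrFun (LinearMap.mem_ker.mp hmem) k
  have hne' : a ≠ 0 ∨ b ≠ 0 ∨ normSq q ≠ 0 := by
    by_contra! h
    exact hne (by simp [h.1, h.2.1, normSq_eq_zero.mp h.2.2])
  obtain ⟨r, hra, hrb, hr⟩ := exists_nonneg_mul_eq_sq_mul hs ht normSq_nonneg hne'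
  obtain ⟨α, β, hα, hβ, hαβ⟩ := exists_normSq_eq_and_mul_star_eq hra hrb
    (hr.trans (normSq_smul r q).symm)
  refine ⟨fun i => u i * α + v i * β, fun k => ?_⟩
  rw [← coe_re_qform (hA k), re_qform_mul_add_mul (hA k), ← hu k, ← hv k, hα, hβ, hαβ,
    mul_smul_comm, re_smul, re_coe, re_coe]
  congr 1
  simp only [Pi.add_apply, Pi.smul_apply, smul_eq_mul]
  linear_combination (-r) * hL k
end

section
/- Let A_0, A_1, A_2, A_3, A_4 be n×n quaternion Hermitian matrices, and define the Hermitian forms F(x) = xᴴA_0x and G_i(x) = xᴴA_ix for i = 1,…,4. Suppose (i) there exists x_0 ∈ ℍⁿ with G_i(x_0) > 0 for i = 1, 2, 3, 4, and (ii) for every x ∈ ℍⁿ, if G_1(x) ≥ 0, G_2(x) ≥ 0, G_3(x) ≥ 0 and G_4(x) ≥ 0 then F(x) ≥ 0. Then there exist real numbers τ_1, τ_2, τ_3, τ_4 ≥ 0 such that F(x) − Σ_{i=1}^4 τ_i G_i(x) ≥ 0 for all x ∈ ℍⁿ (i.e., the S-procedure with four quaternion Hermitian form constraints is lossless). -/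
open Matrix Quaternion BigOperators

/-- Expansion of a quaternionic form along the right span of two vectors. The cross term is
a real-linear function of `b * star a`. -/
theorem qform_right_combination_re {n : ℕ} (A : Matrix (Fin n) (Fin n) ℍ[ℝ])
    (x y : Fin n → ℍ[ℝ]) (a b : ℍ[ℝ]) :
    (qform A (fun i => x i * a + y i * b)).re =
      normSq a * (qform A x).re + normSq b * (qform A y).re +
        ((star x ⬝ᵥ A.mulVec y) * (b * star a) +
          (star y ⬝ᵥ A.mulVec x) * star (b * star a)).re := by
  have hright : ∀ (u v : Fin n → ℍ[ℝ]) (c : ℍ[ℝ]),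
      star u ⬝ᵥ A.mulVec (fun i => v i * c) = (star u ⬝ᵥ A.mulVec v) * c := by
    intro u v c
    simp only [dotProduct, mulVec, Finset.sum_mul, mul_assoc]
  have hleft : ∀ (u v : Fin n → ℍ[ℝ]) (c : ℍ[ℝ]),
      star (fun i => u i * c) ⬝ᵥ v = star c * (star u ⬝ᵥ v) := by
    intro u v c
    simp only [dotProduct, Pi.star_apply, star_mul, Finset.mul_sum, mul_assoc]
  have hsplit : (fun i => x i * a + y i * b) = (fun i => x i * a) + fun i => y i * b := rfl
  simp only [qform]
  rw [hsplit, mulVec_add, star_add, add_dotProduct, dotProduct_add, dotProduct_add]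
  simp only [hleft, hright]
  generalize star x ⬝ᵥ A.mulVec x = p
  generalize star x ⬝ᵥ A.mulVec y = q
  generalize star y ⬝ᵥ A.mulVec x = r
  generalize star y ⬝ᵥ A.mulVec y = s
  simp only [normSq_def', re_add, re_mul, imI_mul, imJ_mul, imK_mul, re_star, imI_star,
    imJ_star, imK_star]
  ring

/-- A nonzero real pencil through the identity meets the boundary of the cone of positive
semidefinite `2 × 2` quaternionic Hermitian matrices. -/
theorem exists_singular_psd_on_line {s t : ℝ} {u : ℍ[ℝ]} (h : (s, t, u) ≠ 0) :
    ∃ l : ℝ, 0 ≤ 1 + l * s ∧ 0 ≤ 1 + l * t ∧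
      normSq (l • u) = (1 + l * s) * (1 + l * t) := by
  wlog hst : s + t ≤ 0 generalizing s t u
  · obtain ⟨l, hs, ht, hu⟩ := this (s := -s) (t := -t) (u := -u)
      (fun h' => h (by simpa [Prod.ext_iff] using h')) (by linarith)
    refine ⟨-l, by linarith, by linarith, ?_⟩
    rw [neg_smul, ← smul_neg, hu]
    ring
  have hu0 : 0 ≤ normSq u := normSq_nonneg
  set r := √((s - t) ^ 2 + 4 * normSq u)
  have hr2 : r ^ 2 = (s - t) ^ 2 + 4 * normSq u := Real.sq_sqrt (by positivity)
  have hr0 : 0 ≤ r := Real.sqrt_nonneg _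
  have habs : |s - t| ≤ r := Real.abs_le_sqrt (by linarith)
  obtain ⟨hlow, hup⟩ := abs_le.mp habs
  have hm : s + t - r < 0 := by
    by_contra! hcon
    have hr' : r = 0 := by linarith
    have hsq : (s - t) ^ 2 = 0 := by nlinarith [sq_nonneg (s - t)]
    have hd : s - t = 0 := by simpa using hsq
    have hu : u = 0 := normSq_eq_zero.mp (by nlinarith)
    exact h (by ext <;> simp [hu] <;> linarith)
  set m := (s + t - r) / 2 with hmdef
  have hm0 : m < 0 := by linarith
  have key : m ^ 2 - m * (s + t) + s * t = normSq u := by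
    rw [hmdef]; linarith
  have hp : ∀ c, 1 + -m⁻¹ * c = (c - m) / -m := by
    intro c
    have := hm0.ne
    field_simp
    ring
  refine ⟨-m⁻¹, ?_, ?_, ?_⟩
  · rw [hp]; exact div_nonneg (by linarith) (by linarith)
  · rw [hp]; exact div_nonneg (by linarith) (by linarith)
  · rw [hp, hp, normSq_smul, ← key]
    field_simp
    ring

/-- Every singular positive semidefinite `2 × 2` quaternionic Hermitian matrix is an outer
product. -/
theorem exists_normSq_eq_and_mul_star_eq_s2 {p q : ℝ} {w : ℍ[ℝ]} (hp : 0 ≤ p) (hq : 0 ≤ q)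
    (hw : normSq w = p * q) :
    ∃ a b : ℍ[ℝ], normSq a = p ∧ normSq b = q ∧ b * star a = w := by
  rcases hp.eq_or_lt with rfl | hp
  · refine ⟨0, ((√q : ℝ) : ℍ[ℝ]), by simp, ?_, ?_⟩
    · rw [normSq_coe, Real.sq_sqrt hq]
    · rw [zero_mul, normSq_eq_zero] at hw
      simp [hw]
  · have hsq : √p ^ 2 = p := Real.sq_sqrt hp.le
    have hne : √p ≠ 0 := (Real.sqrt_pos.mpr hp).ne'
    refine ⟨((√p : ℝ) : ℍ[ℝ]), (√p)⁻¹ • w, ?_, ?_, ?_⟩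
    · rw [normSq_coe, hsq]
    · rw [normSq_smul, hw, inv_pow, hsq]
      field_simp
    · rw [star_coe, mul_coe_eq_smul, smul_smul, mul_inv_cancel₀ hne, one_smul]

/-- The joint range of real parts of quaternionic forms is closed under nonnegative scaling. -/
theorem smul_mem_range_qform {ι : Type*} {n : ℕ} (A : ι → Matrix (Fin n) (Fin n) ℍ[ℝ])
    (x : Fin n → ℍ[ℝ]) {t : ℝ} (ht : 0 ≤ t) :
    (t • fun k => (qform (A k) x).re) ∈
      Set.range fun (x : Fin n → ℍ[ℝ]) k => (qform (A k) x).re := by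
  refine ⟨fun i => x i * ((√t : ℝ) : ℍ[ℝ]) + x i * 0, ?_⟩
  funext k
  simp only [qform_right_combination_re]
  simp [normSq_coe, Real.sq_sqrt ht]

/-- The joint range of at most five quaternionic forms is closed under addition. -/
theorem add_mem_range_qform {ι : Type*} [Fintype ι] (hι : Fintype.card ι ≤ 5) {n : ℕ}
    (A : ι → Matrix (Fin n) (Fin n) ℍ[ℝ]) (x y : Fin n → ℍ[ℝ]) :
    ((fun k => (qform (A k) x).re) + fun k => (qform (A k) y).re) ∈
      Set.range fun (x : Fin n → ℍ[ℝ]) k => (qform (A k) x).re := by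
  let L : (ℝ × ℝ × ℍ[ℝ]) →ₗ[ℝ] (ι → ℝ) :=
    { toFun := fun v k => v.1 * (qform (A k) x).re + v.2.1 * (qform (A k) y).re +
        ((star x ⬝ᵥ (A k).mulVec y) * v.2.2 + (star y ⬝ᵥ (A k).mulVec x) * star v.2.2).re
      map_add' := by
        intro v w
        funext k
        simp only [Prod.fst_add, Prod.snd_add, star_add, mul_add, re_add, Pi.add_apply]
        ring
      map_smul' := by
        intro c v
        funext k
        simp only [Prod.smul_fst, Prod.smul_snd, Quaternion.star_smul, mul_smul_comm, re_add, re_smul,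
          Pi.smul_apply, smul_eq_mul, RingHom.id_apply]
        ring }
  have hL : ∀ a b, L (normSq a, normSq b, b * star a) =
      fun k => (qform (A k) (fun i => x i * a + y i * b)).re := by
    intro a b
    funext k
    exact (qform_right_combination_re (A k) x y a b).symm
  have hrank : Module.finrank ℝ (ι → ℝ) < Module.finrank ℝ (ℝ × ℝ × ℍ[ℝ]) := by
    simp only [Module.finrank_prod, Module.finrank_self, Quaternion.finrank_eq_four,
      Module.finrank_fintype_fun_eq_card]
    omega
  obtain ⟨⟨s, t, u⟩, hker, hne⟩ :=
    Submodule.exists_mem_ne_zero_of_ne_bot (LinearMap.ker_ne_bot_of_finrank_lt hrank)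
  obtain ⟨l, hp, hq, hw⟩ := exists_singular_psd_on_line hne
  obtain ⟨a, b, ha, hb, hab⟩ := exists_normSq_eq_and_mul_star_eq_s2 hp hq hw
  refine ⟨fun i => x i * a + y i * b, ?_⟩
  have hsum : ((1 + l * s, 1 + l * t, l • u) : ℝ × ℝ × ℍ[ℝ]) = (1, 1, 0) + l • (s, t, u) := by
    simp
  refine (hL a b).symm.trans ?_
  rw [ha, hb, hab, hsum, map_add, map_smul, LinearMap.mem_ker.mp hker, smul_zero, add_zero]
  funext k
  simp [L]

/-- The joint range of at most five quaternionic forms is convex. -/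
theorem convex_range_qform {ι : Type*} [Fintype ι] (hι : Fintype.card ι ≤ 5) {n : ℕ}
    (A : ι → Matrix (Fin n) (Fin n) ℍ[ℝ]) :
    Convex ℝ (Set.range fun (x : Fin n → ℍ[ℝ]) k => (qform (A k) x).re) := by
  rintro _ ⟨x, rfl⟩ _ ⟨y, rfl⟩ a b ha hb -
  obtain ⟨x', hx'⟩ := smul_mem_range_qform A x ha
  obtain ⟨y', hy'⟩ := smul_mem_range_qform A y hb
  rw [← hx', ← hy']
  exact add_mem_range_qform hι A x' y'

/-- Lagrange multipliers for a convex cone which misses the open orthant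
`v 0 < 0`, `0 < v i.succ` and satisfies a Slater condition. -/
theorem exists_multipliers_of_convex_cone {m : ℕ} {K : Set (Fin (m + 1) → ℝ)}
    (hconv : Convex ℝ K) (hcone : ∀ v ∈ K, ∀ t : ℝ, 0 ≤ t → t • v ∈ K)
    (hdisj : ∀ v ∈ K, v 0 < 0 → ¬ ∀ i : Fin m, 0 < v i.succ)
    {w : Fin (m + 1) → ℝ} (hwK : w ∈ K) (hw : ∀ i : Fin m, 0 < w i.succ) :
    ∃ τ : Fin m → ℝ, (∀ i, 0 ≤ τ i) ∧ ∀ v ∈ K, ∑ i, τ i * v i.succ ≤ v 0 := by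
  let S : Set (Fin (m + 1) → ℝ) := {v | v 0 < 0 ∧ ∀ i : Fin m, 0 < v i.succ}
  have hSconv : Convex ℝ S := by
    rw [convex_iff_forall_pos]
    rintro v ⟨hv0, hv⟩ z ⟨hz0, hz⟩ a b ha hb -
    refine ⟨?_, fun i => ?_⟩
    · simp only [Pi.add_apply, Pi.smul_apply, smul_eq_mul]
      nlinarith
    · have := mul_pos ha (hv i)
      have := mul_pos hb (hz i)
      simp only [Pi.add_apply, Pi.smul_apply, smul_eq_mul]
      linarith
  have hSopen : IsOpen S := by
    have : S = {v | v 0 < 0} ∩ ⋂ i : Fin m, {v | 0 < v i.succ} := by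
      ext v
      simp [S]
    rw [this]
    exact (isOpen_lt (continuous_apply _) continuous_const).inter
      (isOpen_iInter_of_finite fun i => isOpen_lt continuous_const (continuous_apply _))
  have hSK : Disjoint S K :=
    Set.disjoint_left.mpr fun v hv hvK => hdisj v hvK hv.1 hv.2
  obtain ⟨f, u, hfS, hfK⟩ := geometric_hahn_banach_open hSconv hSopen hconv hSK
  have hu : u ≤ 0 := by simpa using hfK _ (hcone w hwK 0 le_rfl)
  have hK : ∀ v ∈ K, 0 ≤ f v := by
    intro v hv
    by_contra! hneg
    have h := hfK _ (hcone v hv ((u - 1) / f v) (div_nonneg_of_nonpos (by linarith) hneg.le))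
    rw [map_smul, smul_eq_mul, div_mul_cancel₀ _ hneg.ne] at h
    linarith
  have hS : ∀ v : Fin (m + 1) → ℝ, v 0 < 0 → (∀ i : Fin m, 0 < v i.succ) → f v < 0 :=
    fun v h0 h => (hfS v ⟨h0, h⟩).trans_le hu
  let z : Fin (m + 1) → ℝ := Fin.cons (-1) fun i => w i.succ
  have hz : f z < 0 := hS z (by simp [z]) (by simpa [z] using hw)
  have hclosed : ∀ v : Fin (m + 1) → ℝ, v 0 ≤ 0 → (∀ i : Fin m, 0 ≤ v i.succ) → f v ≤ 0 := by
    intro v h0 h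
    by_contra! hpos
    have hc : 0 < f v / -f z := div_pos hpos (by linarith)
    have hlt := hS (v + (f v / -f z) • z) (by simp [z]; linarith) (fun i => by
      have := mul_pos hc (hw i)
      have := h i
      simp only [Pi.add_apply, Pi.smul_apply, smul_eq_mul, z, Fin.cons_succ]
      linarith)
    rw [map_add, map_smul, smul_eq_mul] at hlt
    have : f v / -f z * f z = -f v := by
      have := hz.ne
      field_simp
    linarith
  let c : Fin (m + 1) → ℝ := fun i => f (Pi.single i 1)
  have hf : ∀ v, f v = v 0 * c 0 + ∑ i : Fin m, v i.succ * c i.succ := by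
    intro v
    rw [← Fin.sum_univ_succ (fun i => v i * c i)]
    conv_lhs => rw [← Finset.univ_sum_single v, map_sum]
    refine Finset.sum_congr rfl fun i _ => ?_
    rw [← smul_eq_mul, ← map_smul, ← Pi.single_smul, smul_eq_mul, mul_one]
  have hc : ∀ i : Fin m, c i.succ ≤ 0 := fun i =>
    hclosed (Pi.single i.succ 1) (by simp) fun j => by
      rw [Pi.single_apply]
      split_ifs <;> norm_num
  have hc0 : 0 ≤ c 0 := by
    have := hclosed (-Pi.single 0 1) (by simp) (by simp)
    rw [map_neg] at this
    exact neg_nonpos.mp this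
  have hc0' : 0 < c 0 := by
    refine hc0.lt_of_ne fun h => ?_
    have h1 := hK w hwK
    have h2 := hz
    rw [hf, ← h] at h1 h2
    simp only [z, Fin.cons_succ] at h2
    linarith
  refine ⟨fun i => -c i.succ / c 0, fun i => div_nonneg (neg_nonneg.mpr (hc i)) hc0, ?_⟩
  intro v hv
  have h := hK v hv
  rw [hf] at h
  have hsum : ∑ i : Fin m, -c i.succ / c 0 * v i.succ =
      -(∑ i : Fin m, v i.succ * c i.succ) / c 0 := by
    rw [neg_div, Finset.sum_div, ← Finset.sum_neg_distrib]
    exact Finset.sum_congr rfl fun i _ => by ring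
  rw [hsum, div_le_iff₀ hc0']
  linarith

/-- The S-procedure with four quaternion Hermitian form constraints is lossless. -/
theorem sProcedure_quaternion_lossless_four {n : ℕ}
    (A₀ A₁ A₂ A₃ A₄ : Matrix (Fin n) (Fin n) ℍ[ℝ])
    (h₀ : A₀.IsHermitian) (h₁ : A₁.IsHermitian) (h₂ : A₂.IsHermitian)
    (h₃ : A₃.IsHermitian) (h₄ : A₄.IsHermitian)
    (x₀ : Fin n → ℍ[ℝ])
    (hslater : 0 < (qform A₁ x₀).re ∧ 0 < (qform A₂ x₀).re ∧
               0 < (qform A₃ x₀).re ∧ 0 < (qform A₄ x₀).re)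
    (himp : ∀ x : Fin n → ℍ[ℝ],
      0 ≤ (qform A₁ x).re → 0 ≤ (qform A₂ x).re →
      0 ≤ (qform A₃ x).re → 0 ≤ (qform A₄ x).re → 0 ≤ (qform A₀ x).re) :
    ∃ τ₁ τ₂ τ₃ τ₄ : ℝ, 0 ≤ τ₁ ∧ 0 ≤ τ₂ ∧ 0 ≤ τ₃ ∧ 0 ≤ τ₄ ∧
      ∀ x : Fin n → ℍ[ℝ],
        0 ≤ (qform A₀ x).re - (τ₁ * (qform A₁ x).re + τ₂ * (qform A₂ x).re +
              τ₃ * (qform A₃ x).re + τ₄ * (qform A₄ x).re) := by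
  let A : Fin 5 → Matrix (Fin n) (Fin n) ℍ[ℝ] := ![A₀, A₁, A₂, A₃, A₄]
  let Φ : (Fin n → ℍ[ℝ]) → Fin 5 → ℝ := fun x k => (qform (A k) x).re
  have hconv : Convex ℝ (Set.range Φ) := convex_range_qform (by simp) A
  have hcone : ∀ v ∈ Set.range Φ, ∀ t : ℝ, 0 ≤ t → t • v ∈ Set.range Φ := by
    rintro _ ⟨x, rfl⟩ t ht
    exact smul_mem_range_qform A x ht
  have hdisj : ∀ v ∈ Set.range Φ, v 0 < 0 → ¬ ∀ i : Fin 4, 0 < v i.succ := by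
    rintro _ ⟨x, rfl⟩ hx hpos
    exact hx.not_ge (himp x (hpos 0).le (hpos 1).le (hpos 2).le (hpos 3).le)
  have hslater' : ∀ i : Fin 4, 0 < Φ x₀ i.succ := by
    obtain ⟨p₁, p₂, p₃, p₄⟩ := hslater
    intro i
    fin_cases i
    exacts [p₁, p₂, p₃, p₄]
  obtain ⟨τ, hτ, h⟩ := exists_multipliers_of_convex_cone hconv hcone hdisj ⟨x₀, rfl⟩ hslater'
  refine ⟨τ 0, τ 1, τ 2, τ 3, hτ 0, hτ 1, hτ 2, hτ 3, fun x => ?_⟩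
  have hx := h (Φ x) ⟨x, rfl⟩
  rw [Fin.sum_univ_four] at hx
  exact sub_nonneg.mpr hx
end

section
/- Let Y be an n×n real symmetric positive semidefinite matrix of rank r ≥ 1 and let B be an n×n real symmetric matrix. Then there exist vectors y_1, …, y_r ∈ ℝⁿ such that Y = Σ_{i=1}^r y_i y_iᵀ and y_iᵀB y_i = (B • Y)/r for every i = 1, …, r. -/
open Matrix BigOperators

/-- Replacing two members of a finite family by two others with the same total contribution
leaves the sum unchanged. -/
theorem sum_update_update_eq {ι α M : Type*} [Fintype ι] [DecidableEq ι] [AddCommMonoid M]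
    (F : α → M) (y : ι → α) {i j : ι} (hij : i ≠ j) (u v : α)
    (h : F u + F v = F (y i) + F (y j)) :
    ∑ k, F (Function.update (Function.update y i u) j v k) = ∑ k, F (y k) := by
  have hi : i ∈ Finset.univ.erase j := by simp [hij]
  rw [← Finset.add_sum_erase _ _ (Finset.mem_univ j), ← Finset.add_sum_erase _ _ hi,
    ← Finset.add_sum_erase _ (fun k => F (y k)) (Finset.mem_univ j),
    ← Finset.add_sum_erase _ (fun k => F (y k)) hi, ← add_assoc, ← add_assoc]
  congr 1
  · simpa [hij, add_comm] using h
  · refine Finset.sum_congr rfl fun k hk => ?_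
    simp only [Finset.mem_erase] at hk
    simp [hk.1, hk.2.1]

theorem trace_transpose_mul_sum_vecMulVec {m ι : Type*} [Fintype m] [Fintype ι]
    (B : Matrix m m ℝ) (y : ι → m → ℝ) :
    trace (Bᵀ * ∑ i, vecMulVec (y i) (y i)) = ∑ i, y i ⬝ᵥ B *ᵥ y i := by
  rw [Finset.mul_sum, trace_sum]
  refine Finset.sum_congr rfl fun i _ => ?_
  rw [mul_vecMulVec, trace_vecMulVec, mulVec_transpose, dotProduct_mulVec]

/-- A pair of vectors can be rotated so that a quadratic form takes a prescribed intermediate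
value at the first one. -/
theorem exists_vecMulVec_add_eq_of_lt_of_lt {m : Type*} [Fintype m] (B : Matrix m m ℝ)
    (a b : m → ℝ) {c : ℝ} (ha : a ⬝ᵥ B *ᵥ a < c) (hb : c < b ⬝ᵥ B *ᵥ b) :
    ∃ u v : m → ℝ, vecMulVec u u + vecMulVec v v = vecMulVec a a + vecMulVec b b ∧
      u ⬝ᵥ B *ᵥ u = c := by
  let w : ℝ → m → ℝ := fun t => Real.cos t • a + Real.sin t • b
  have hw : Continuous fun t => w t ⬝ᵥ B *ᵥ w t := by
    have : Continuous w := by fun_prop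
    exact this.dotProduct (continuous_const.matrix_mulVec this)
  obtain ⟨t, -, ht⟩ := intermediate_value_Icc (Real.pi_div_two_pos.le) hw.continuousOn
    (show c ∈ Set.Icc _ _ from ⟨by simpa [w] using ha.le, by simpa [w] using hb.le⟩)
  refine ⟨w t, -Real.sin t • a + Real.cos t • b, ?_, ht⟩
  ext k l
  simp only [w, Matrix.add_apply, vecMulVec_apply, Pi.add_apply, Pi.smul_apply, smul_eq_mul]
  linear_combination (a k * a l + b k * b l) * Real.sin_sq_add_cos_sq t

/-- A sum of `vecMulVec (y i) (y i)` can be rewritten, with the same number of terms, so that a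
given quadratic form takes the same value on every term. -/
theorem exists_sum_vecMulVec_eq_and_forall_eq {m ι : Type*} [Fintype m] [Fintype ι]
    (B : Matrix m m ℝ) (c : ℝ) (y : ι → m → ℝ)
    (hc : ∑ i, y i ⬝ᵥ B *ᵥ y i = Fintype.card ι * c) :
    ∃ z : ι → m → ℝ, ∑ i, vecMulVec (z i) (z i) = ∑ i, vecMulVec (y i) (y i) ∧
      ∀ i, z i ⬝ᵥ B *ᵥ z i = c := by
  classical
  induction hN : (Finset.univ.filter fun i => y i ⬝ᵥ B *ᵥ y i ≠ c).card using
    Nat.strong_induction_on generalizing y with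
  | _ N ih =>
    by_cases hall : ∀ i, y i ⬝ᵥ B *ᵥ y i = c
    · exact ⟨y, rfl, hall⟩
    have hsum : ∑ i, (y i ⬝ᵥ B *ᵥ y i - c) = 0 := by
      simp [Finset.sum_sub_distrib, hc]
    have hne : ∃ i ∈ Finset.univ, y i ⬝ᵥ B *ᵥ y i - c ≠ 0 := by
      simpa [sub_eq_zero] using hall
    obtain ⟨j, -, hj⟩ := Finset.exists_pos_of_sum_zero_of_exists_nonzero _ hsum hne
    obtain ⟨i, -, hi⟩ := Finset.exists_pos_of_sum_zero_of_exists_nonzero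
      (fun i => -(y i ⬝ᵥ B *ᵥ y i - c)) (by rw [Finset.sum_neg_distrib, hsum, neg_zero])
      (by simpa only [neg_ne_zero] using hne)
    have hi' : y i ⬝ᵥ B *ᵥ y i < c := by linarith
    have hj' : c < y j ⬝ᵥ B *ᵥ y j := by linarith
    have hij : i ≠ j := by rintro rfl; linarith
    obtain ⟨u, v, huv, hu⟩ := exists_vecMulVec_add_eq_of_lt_of_lt B (y i) (y j) hi' hj'
    have hsame := sum_update_update_eq (fun x : m → ℝ => vecMulVec x x) y hij u v huv
    have hlt : (Finset.univ.filter fun k => Function.update (Function.update y i u) j v k ⬝ᵥ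
        B *ᵥ Function.update (Function.update y i u) j v k ≠ c).card < N := by
      rw [← hN]
      refine Finset.card_lt_card ((Finset.ssubset_iff_of_subset ?_).2 ⟨i, ?_, ?_⟩)
      · intro k hk
        simp only [Finset.mem_filter, Finset.mem_univ, true_and] at hk ⊢
        rcases eq_or_ne k j with rfl | hkj
        · exact hj'.ne'
        rcases eq_or_ne k i with rfl | hki
        · exact hi'.ne
        · simpa [hkj, hki] using hk
      · simpa using hi'.ne
      · simp [hij, hu]
    obtain ⟨z, hz, hzc⟩ := ih _ hlt (Function.update (Function.update y i u) j v)
      (by rw [← trace_transpose_mul_sum_vecMulVec, hsame, trace_transpose_mul_sum_vecMulVec, hc])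
      rfl
    exact ⟨z, hz.trans hsame, hzc⟩

theorem Matrix.PosSemidef.exists_eq_sum_vecMulVec_rank {m : Type*} [Fintype m]
    {Y : Matrix m m ℝ} (hY : Y.PosSemidef) :
    ∃ y : Fin Y.rank → m → ℝ, Y = ∑ i, vecMulVec (y i) (y i) := by
  classical
  let lam := hY.isHermitian.eigenvalues
  let x : m → m → ℝ := fun i k => √(lam i) * hY.isHermitian.eigenvectorUnitary.1 k i
  have hx : Y = ∑ i, vecMulVec (x i) (x i) := by
    conv_lhs => rw [hY.isHermitian.spectral_theorem]
    ext k l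
    rw [Unitary.conjStarAlgAut_apply, Matrix.mul_apply]
    simp only [Matrix.mul_diagonal, Matrix.sum_apply, vecMulVec_apply, x]
    refine Finset.sum_congr rfl fun i _ => ?_
    have := Real.mul_self_sqrt (hY.eigenvalues_nonneg i)
    simp only [Function.comp_apply, star_apply, star_trivial, RCLike.ofReal_real_eq_id, id]
    linear_combination -(hY.isHermitian.eigenvectorUnitary.1 k i *
      hY.isHermitian.eigenvectorUnitary.1 l i) * this
  let e : Fin Y.rank ≃ {i // lam i ≠ 0} :=
    (finCongr hY.isHermitian.rank_eq_card_non_zero_eigs).trans (Fintype.equivFin _).symm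
  refine ⟨fun i => x (e i), hx.trans ?_⟩
  rw [e.sum_comp fun i => vecMulVec (x i) (x i),
    ← Finset.sum_subtype (Finset.univ.filter fun i => lam i ≠ 0) (by simp)
      fun i => vecMulVec (x i) (x i)]
  refine (Finset.sum_filter_of_ne (p := fun i => lam i ≠ 0) fun i _ hi h0 => hi ?_).symm
  ext k l
  simp [x, h0, vecMulVec_apply]

/-- Sturm–Zhang: a real symmetric PSD matrix `Y` of rank `r ≥ 1` admits a
rank-one decomposition `Y = Σ yᵢyᵢᵀ` with `yᵢᵀByᵢ = (B • Y)/r` for all `i`,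
where `B • Y = tr (Bᵀ Y)`. -/
theorem real_rank_one_decomposition {n r : ℕ} (hr : 1 ≤ r)
    (Y B : Matrix (Fin n) (Fin n) ℝ) (hY : Y.PosSemidef) (hB : B.IsSymm)
    (hrank : Y.rank = r) :
    ∃ y : Fin r → (Fin n → ℝ),
      Y = ∑ i, vecMulVec (y i) (y i) ∧
      ∀ i, y i ⬝ᵥ B.mulVec (y i) = Matrix.trace (Bᵀ * Y) / r := by
  subst hrank
  obtain ⟨y, hy⟩ := hY.exists_eq_sum_vecMulVec_rank
  have hr' : (Y.rank : ℝ) ≠ 0 := by positivity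
  obtain ⟨z, hz, hzc⟩ := exists_sum_vecMulVec_eq_and_forall_eq B (trace (Bᵀ * Y) / Y.rank) y (by
    rw [← trace_transpose_mul_sum_vecMulVec, ← hy, Fintype.card_fin, mul_div_cancel₀ _ hr'])
  exact ⟨z, hy.trans hz.symm, hzc⟩
end

section
/- Let Z be an n×n complex Hermitian positive semidefinite matrix of rank r ≥ 1 and let C_1, C_2 be n×n complex Hermitian matrices. Then there exist vectors z_1, …, z_r ∈ ℂⁿ such that Z = Σ_{i=1}^r z_i z_iᴴ and z_iᴴ C_k z_i = (C_k • Z)/r for every i = 1, …, r and k = 1, 2. -/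
open Matrix BigOperators
open scoped ComplexOrder

/-- Some unit complex number `u` makes `u * b + star u * c` real. -/
lemma exists_unit_mul_add_star_mul_real (b c : ℂ) :
    ∃ (u : ℂ) (k : ℝ), u * star u = 1 ∧ u * b + star u * c = k := by
  obtain ⟨u, hu, him⟩ : ∃ u : ℂ, u * star u = 1 ∧ (u * (b - star c)).im = 0 := by
    by_cases hw : b - star c = 0
    · exact ⟨1, by simp, by rw [hw, mul_zero, Complex.zero_im]⟩
    · have hn : ((‖b - star c‖ : ℝ) : ℂ) ≠ 0 := by simpa using hw
      have hmul : star (b - star c) * (b - star c) = (‖b - star c‖ : ℂ) ^ 2 := Complex.conj_mul' _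
      refine ⟨star (b - star c) / ‖b - star c‖, ?_, ?_⟩
      · rw [star_div₀, star_star, Complex.star_def, Complex.conj_ofReal, div_mul_div_comm,
          ← Complex.star_def, hmul]
        field_simp
      · rw [div_mul_eq_mul_div, hmul, pow_two, mul_div_cancel_right₀ _ hn, Complex.ofReal_im]
  refine ⟨u, (u * b + star u * c).re, hu, Complex.ext rfl ?_⟩
  rw [Complex.ofReal_im, ← him]
  simp [Complex.mul_im]
  ring

/-- The values of the quadratic form of a `2 × 2` complex matrix on the unit sphere contain the
segment between the diagonal entries. -/
lemma exists_rotation_eq_convex_combination {l : ℝ} (hl₀ : 0 < l) (hl₁ : l ≤ 1) (a b c d : ℂ) :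
    ∃ (p s : ℝ) (u : ℂ), p ^ 2 + s ^ 2 = 1 ∧ u * star u = 1 ∧
      p ^ 2 * a + s ^ 2 * d + p * s * (u * b + star u * c) = l * a + (1 - l) * d := by
  by_cases had : a - d = 0
  · obtain rfl := sub_eq_zero.mp had
    exact ⟨1, 0, 1, by simp, by simp, by push_cast; ring⟩
  obtain ⟨u, k, hu, hk⟩ := exists_unit_mul_add_star_mul_real (b / (a - d)) (c / (a - d))
  obtain ⟨t, ht⟩ : ∃ t : ℝ, (1 - l) - l * t ^ 2 + t * k = 0 := by
    obtain ⟨q, hq⟩ : ∃ q : ℝ, q ^ 2 = k ^ 2 + 4 * l * (1 - l) := by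
      have := sub_nonneg.mpr hl₁
      exact ⟨_, Real.sq_sqrt (by positivity)⟩
    refine ⟨(k + q) / (2 * l), ?_⟩
    field_simp
    linear_combination -hq
  have hpos : 0 < 1 + t ^ 2 := by positivity
  have hq : √(1 + t ^ 2) ^ 2 = 1 + t ^ 2 := Real.sq_sqrt hpos.le
  have hq₀ : √(1 + t ^ 2) ≠ 0 := (Real.sqrt_pos.mpr hpos).ne'
  refine ⟨1 / √(1 + t ^ 2), t / √(1 + t ^ 2), u, ?_, hu, ?_⟩
  · rw [div_pow, div_pow, hq]
    field_simp
  · have hk' : u * b + star u * c = k * (a - d) := by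
      rw [← hk]
      field_simp
    have hqc : ((√(1 + t ^ 2) : ℝ) : ℂ) ^ 2 = 1 + (t : ℂ) ^ 2 := by exact_mod_cast hq
    have hqc₀ : ((√(1 + t ^ 2) : ℝ) : ℂ) ≠ 0 := by exact_mod_cast hq₀
    have htc : (1 - l : ℂ) - l * (t : ℂ) ^ 2 + t * k = 0 := by exact_mod_cast ht
    rw [hk']
    push_cast
    field_simp
    rw [hqc]
    linear_combination (a - d) * htc

section RankOne

variable {ι : Type*} [Fintype ι]

lemma trace_mul_vecMulVec_star (A : Matrix ι ι ℂ) (x : ι → ℂ) :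
    (A * vecMulVec x (star x)).trace = star x ⬝ᵥ A *ᵥ x := by
  rw [mul_vecMulVec, trace_vecMulVec, dotProduct_comm]

lemma trace_mul_sum_vecMulVec_star {κ : Type*} [Fintype κ] (A : Matrix ι ι ℂ) (z : κ → ι → ℂ) :
    (A * ∑ i, vecMulVec (z i) (star (z i))).trace = ∑ i, star (z i) ⬝ᵥ A *ᵥ z i := by
  simp_rw [Finset.mul_sum, trace_sum, trace_mul_vecMulVec_star]

/-- Two vectors can be rotated, preserving the sum of their rank-one matrices, so that the
quadratic form of `A` takes at the first one any prescribed value between the original two. -/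
lemma exists_pair_rotation {l : ℝ} (hl₀ : 0 < l) (hl₁ : l ≤ 1) (A : Matrix ι ι ℂ) (x y : ι → ℂ) :
    ∃ x' y' : ι → ℂ,
      vecMulVec x' (star x') + vecMulVec y' (star y') =
        vecMulVec x (star x) + vecMulVec y (star y) ∧
      star x' ⬝ᵥ A *ᵥ x' = l * (star x ⬝ᵥ A *ᵥ x) + (1 - l) * (star y ⬝ᵥ A *ᵥ y) := by
  obtain ⟨p, s, u, hps, hu, h⟩ := exists_rotation_eq_convex_combination hl₀ hl₁
    (star x ⬝ᵥ A *ᵥ x) (star x ⬝ᵥ A *ᵥ y) (star y ⬝ᵥ A *ᵥ x) (star y ⬝ᵥ A *ᵥ y)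
  have hpsc : (p : ℂ) ^ 2 + (s : ℂ) ^ 2 = 1 := by exact_mod_cast hps
  refine ⟨(p : ℂ) • x + (s * u) • y, (-s : ℂ) • x + (p * u) • y, ?_, ?_⟩
  · ext i j
    simp only [Matrix.add_apply, vecMulVec_apply, Pi.add_apply, Pi.smul_apply, Pi.star_apply,
      smul_eq_mul, star_add, star_mul', star_neg, Complex.star_def, Complex.conj_ofReal] at hu ⊢
    linear_combination (x i * starRingEnd ℂ (x j) + y i * starRingEnd ℂ (y j)) * hpsc +
      (p ^ 2 + s ^ 2) * (y i * starRingEnd ℂ (y j)) * hu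
  · rw [← h]
    simp only [star_add, star_smul, mulVec_add, mulVec_smul, dotProduct_add, add_dotProduct,
      smul_dotProduct, dotProduct_smul, smul_eq_mul, star_mul', Complex.star_def,
      Complex.conj_ofReal] at hu ⊢
    linear_combination s ^ 2 * (star y ⬝ᵥ A *ᵥ y) * hu

/-- Any finite family of vectors can be changed, preserving the sum of the rank-one matrices, so
that the quadratic form of `A` is constant on it. -/
lemma exists_family_quadratic_form_const (A : Matrix ι ι ℂ) (m : ℕ) (z : Fin (m + 1) → ι → ℂ) :
    ∃ w : Fin (m + 1) → ι → ℂ,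
      ∑ i, vecMulVec (w i) (star (w i)) = ∑ i, vecMulVec (z i) (star (z i)) ∧
      ∀ i, star (w i) ⬝ᵥ A *ᵥ w i =
        (A * ∑ i, vecMulVec (z i) (star (z i))).trace / ((m + 1 : ℕ) : ℂ) := by
  induction m with
  | zero =>
    refine ⟨z, rfl, fun i => ?_⟩
    simp [trace_mul_vecMulVec_star, Fin.fin_one_eq_zero i]
  | succ m ih =>
    obtain ⟨w, hw, hwA⟩ := ih (Fin.tail z)
    have hm₁ : ((m : ℂ) + 1) ≠ 0 := by exact_mod_cast m.succ_ne_zero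
    have hm₂ : ((m : ℂ) + 1 + 1) ≠ 0 := by exact_mod_cast (m + 1).succ_ne_zero
    have hl₁ : (1 : ℝ) / (m + 1 + 1) ≤ 1 := by
      rw [div_le_one (by positivity)]
      linarith [(m.cast_nonneg : (0 : ℝ) ≤ m)]
    obtain ⟨x, y, hxy, hx⟩ := exists_pair_rotation (by positivity) hl₁ A (z 0) (w 0)
    obtain ⟨v, hv, hvA⟩ := ih (Fin.cons y (Fin.tail w))
    have hZ : vecMulVec x (star x) + ∑ i, vecMulVec (v i) (star (v i)) =
        ∑ i, vecMulVec (z i) (star (z i)) := by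
      rw [hv, Fin.sum_univ_succ, Fin.sum_univ_succ (fun i => vecMulVec (z i) (star (z i)))]
      simp only [Fin.cons_zero, Fin.cons_succ]
      rw [← add_assoc, hxy, add_assoc]
      congr 1
      rw [Fin.sum_univ_succ] at hw
      exact hw
    have hxA : star x ⬝ᵥ A *ᵥ x =
        (A * ∑ i, vecMulVec (z i) (star (z i))).trace / ((m + 1 + 1 : ℕ) : ℂ) := by
      rw [hx, hwA, Fin.sum_univ_succ (fun i => vecMulVec (z i) (star (z i))), mul_add, trace_add,
        trace_mul_vecMulVec_star]
      simp only [Fin.tail]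
      push_cast
      field_simp
      ring
    refine ⟨Fin.cons x v, ?_, Fin.cases ?_ fun i => ?_⟩
    · rw [Fin.sum_univ_succ]
      simpa using hZ
    · simpa using hxA
    · rw [Fin.cons_succ, hvA, ← hv, eq_sub_of_add_eq' hZ, mul_sub, trace_sub,
        trace_mul_vecMulVec_star, hxA]
      push_cast
      field_simp
      ring

/-- A positive semidefinite matrix is a sum of as many rank-one matrices as its rank. -/
lemma Matrix.PosSemidef.exists_eq_sum_vecMulVec_star {Z : Matrix ι ι ℂ} (hZ : Z.PosSemidef) :
    ∃ z : Fin Z.rank → ι → ℂ, Z = ∑ i, vecMulVec (z i) (star (z i)) := by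
  classical
  let ev := hZ.1.eigenvalues
  let f : ι → ι → ℂ := fun i => ((√(ev i) : ℝ) : ℂ) • ⇑(hZ.1.eigenvectorBasis i)
  have hf : Z = ∑ i, vecMulVec (f i) (star (f i)) := by
    conv_lhs => rw [hZ.1.spectral_theorem, Unitary.conjStarAlgAut_apply]
    ext j k
    rw [Matrix.mul_apply, Matrix.sum_apply]
    refine Finset.sum_congr rfl fun i _ => ?_
    have hs : ((√(ev i) : ℝ) : ℂ) * ((√(ev i) : ℝ) : ℂ) = (ev i : ℂ) := by
      exact_mod_cast Real.mul_self_sqrt (hZ.eigenvalues_nonneg i)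
    simp only [f, ev, mul_diagonal, vecMulVec_apply, Pi.smul_apply, Pi.star_apply, smul_eq_mul,
      star_mul', Complex.star_def, Complex.conj_ofReal, star_apply, Function.comp_apply,
      IsHermitian.eigenvectorUnitary_apply] at hs ⊢
    rw [RCLike.ofReal_eq_complex_ofReal, ← hs]
    ring
  let e : Fin Z.rank ≃ {i // ev i ≠ 0} :=
    (Fintype.equivFinOfCardEq hZ.1.rank_eq_card_non_zero_eigs.symm).symm
  refine ⟨fun i => f (e i), ?_⟩
  rw [e.sum_comp (fun i => vecMulVec (f i) (star (f i)))]
  refine hf.trans ?_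
  rw [← Finset.sum_subtype (Finset.univ.filter fun i => ev i ≠ 0) (by simp)
    (fun i => vecMulVec (f i) (star (f i)))]
  symm
  apply Finset.sum_filter_of_ne
  intro i _ hi h₀
  exact hi (by simp [f, h₀])

end RankOne

/-- Huang–Zhang: a complex Hermitian PSD matrix `Z` of rank `r ≥ 1` admits a
rank-one decomposition `Z = Σ zᵢzᵢᴴ` with `zᵢᴴCₖzᵢ = (Cₖ • Z)/r` for all `i`
and `k = 1, 2`, where `C • Z = Re (tr (Cᴴ Z))`. -/
theorem complex_rank_one_decomposition_two {n r : ℕ} (hr : 1 ≤ r)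
    (Z C₁ C₂ : Matrix (Fin n) (Fin n) ℂ) (hZ : Z.PosSemidef)
    (h₁ : C₁.IsHermitian) (h₂ : C₂.IsHermitian) (hrank : Z.rank = r) :
    ∃ z : Fin r → (Fin n → ℂ),
      Z = ∑ i, vecMulVec (z i) (star (z i)) ∧
      ∀ i,
        star (z i) ⬝ᵥ C₁.mulVec (z i) = (((Matrix.trace (C₁ᴴ * Z)).re / r : ℝ) : ℂ) ∧
        star (z i) ⬝ᵥ C₂.mulVec (z i) = (((Matrix.trace (C₂ᴴ * Z)).re / r : ℝ) : ℂ) := by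
  obtain ⟨m, rfl⟩ : ∃ m, r = m + 1 := ⟨r - 1, by omega⟩
  obtain ⟨z₀, hz₀⟩ : ∃ z : Fin (m + 1) → Fin n → ℂ, Z = ∑ i, vecMulVec (z i) (star (z i)) :=
    hrank ▸ hZ.exists_eq_sum_vecMulVec_star
  obtain ⟨z, hz, hzA⟩ := exists_family_quadratic_form_const (C₁ + Complex.I • C₂) m z₀
  rw [← hz₀] at hz hzA
  have him : ∀ {C : Matrix (Fin n) (Fin n) ℂ}, C.IsHermitian → ∀ x : Fin n → ℂ,
      (star x ⬝ᵥ C *ᵥ x).im = 0 := fun hC x => hC.im_star_dotProduct_mulVec_self x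
  have htr : ∀ {C : Matrix (Fin n) (Fin n) ℂ}, C.IsHermitian → (C * Z).trace.im = 0 := by
    intro C hC
    rw [← hz, trace_mul_sum_vecMulVec_star, Complex.im_sum]
    exact Finset.sum_eq_zero fun i _ => him hC _
  refine ⟨z, hz.symm, fun i => ?_⟩
  have h := hzA i
  rw [add_mulVec, smul_mulVec, dotProduct_add, dotProduct_smul, add_mul, smul_mul, trace_add,
    trace_smul, smul_eq_mul, smul_eq_mul] at h
  have hre := congrArg Complex.re h
  have him' := congrArg Complex.im h
  rw [Complex.div_natCast_re] at hre
  rw [Complex.div_natCast_im] at him'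
  simp only [Complex.add_re, Complex.add_im, Complex.I_mul_re, Complex.I_mul_im, him h₁, him h₂,
    htr h₁, htr h₂, neg_zero, add_zero, zero_add] at hre him'
  rw [h₁.eq, h₂.eq]
  exact ⟨Complex.ext hre (him h₁ _), Complex.ext him' (him h₂ _)⟩
end

section
/- Let n be a positive integer with n ≠ 2 and let A_1, …, A_5 be n×n quaternion Hermitian matrices. Then the set { (xᴴA_1x, …, xᴴA_5x) : x ∈ ℍⁿ, xᴴx = 1 } is a convex subset of ℝ⁵. -/
open Matrix Quaternion BigOperators

/-- If `r • id + M` is perturbed by affine data growing linearly in `r`, then its zeros exist and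
stay bounded as `r` grows. -/
lemma exists_bounded_zero_of_large_smul (M : ℍ[ℝ] →L[ℝ] ℍ[ℝ]) (e d : ℍ[ℝ]) :
    ∃ C R₀ : ℝ, 0 ≤ C ∧ ∀ R, R₀ ≤ R → ∃ u, R • u + M u + R • e + d = 0 ∧ ‖u‖ ≤ C := by
  refine ⟨2 * (‖e‖ + 1), 2 * ‖M‖ + ‖d‖ + 1, by positivity, fun R hR => ?_⟩
  have hM := norm_nonneg M
  have hd := norm_nonneg d
  have he := norm_nonneg e
  have hRpos : 0 < R := by linarith
  have lower (u : ℍ[ℝ]) : R / 2 * ‖u‖ ≤ ‖R • u + M u‖ := by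
    have h1 := norm_sub_le (R • u + M u) (M u)
    rw [add_sub_cancel_right, norm_smul, Real.norm_of_nonneg hRpos.le] at h1
    nlinarith [M.le_opNorm u, norm_nonneg u]
  let S : ℍ[ℝ] →ₗ[ℝ] ℍ[ℝ] := R • LinearMap.id + (M : ℍ[ℝ] →ₗ[ℝ] ℍ[ℝ])
  have hS (u : ℍ[ℝ]) : S u = R • u + M u := rfl
  have hinj : Function.Injective S := by
    rw [injective_iff_map_eq_zero]
    intro u hu
    have h := lower u
    rw [← hS, hu, norm_zero] at h
    have : ‖u‖ ≤ 0 := by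
      by_contra! h0
      nlinarith [mul_pos hRpos h0]
    simpa using this
  obtain ⟨u, hu⟩ := LinearMap.injective_iff_surjective.mp hinj (-(R • e + d))
  rw [hS] at hu
  refine ⟨u, by rw [add_assoc, hu, neg_add_cancel], ?_⟩
  have h := lower u
  rw [hu, norm_neg] at h
  have h2 := norm_add_le (R • e) d
  rw [norm_smul, Real.norm_of_nonneg hRpos.le] at h2
  by_contra! h3
  nlinarith [mul_pos hRpos (sub_pos.2 h3)]

/-- Near a parameter at which it is injective, a continuous family of linear equations has a
continuous solution. -/
lemma exists_continuousAt_solution {X E : Type*} [TopologicalSpace X] [NormedAddCommGroup E]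
    [NormedSpace ℝ E] [FiniteDimensional ℝ E] {T : X → E →L[ℝ] E} {f : X → E} {b : X}
    (hT : ContinuousAt T b) (hf : ContinuousAt f b) (hinj : Function.Injective (T b)) :
    ∃ sol : X → E, ContinuousAt sol b ∧ ∀ᶠ b' in nhds b, T b' (sol b') = f b' := by
  have : CompleteSpace E := FiniteDimensional.complete ℝ E
  have hunit : IsUnit (T b) := ContinuousLinearMap.isUnit_iff_bijective.2
    ⟨hinj, LinearMap.injective_iff_surjective (f := (T b : E →ₗ[ℝ] E)).mp hinj⟩
  obtain ⟨u, hu⟩ := hunit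
  refine ⟨fun b' => Ring.inverse (T b') (f b'), ?_, ?_⟩
  · have hinv : ContinuousAt (Ring.inverse (M₀ := E →L[ℝ] E)) (T b) :=
      hu ▸ NormedRing.inverse_continuousAt (R := E →L[ℝ] E) u
    exact (ContinuousAt.comp (f := T) hinv hT).clm_apply hf
  · have hev : ∀ᶠ b' in nhds b, IsUnit (T b') := hT.eventually (hu ▸ u.nhds)
    filter_upwards [hev] with b' hb'
    rw [← mul_apply_eq_comp, Ring.mul_inverse_cancel _ hb', one_apply_eq_self]

/-- An inhomogeneous quadratic system whose leading part is the quaternionic Hopf map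
`(a, b) ↦ (|a|² - κ |b|², b ā)` always has a solution. -/
lemma exists_zero_of_hopf_leading_part {κ : ℝ} (hκ : 0 < κ) (l₁ l₂ : ℍ[ℝ] →L[ℝ] ℝ) (c : ℝ)
    (M₁ M₂ : ℍ[ℝ] →L[ℝ] ℍ[ℝ]) (d : ℍ[ℝ]) :
    ∃ a b : ℍ[ℝ], ‖a‖ ^ 2 - κ * ‖b‖ ^ 2 + l₁ a + l₂ b + c = 0 ∧
      b * star a + M₁ a + M₂ b + d = 0 := by
  by_contra! hno
  let h : ℍ[ℝ] → ℍ[ℝ] → ℝ := fun a b => ‖a‖ ^ 2 - κ * ‖b‖ ^ 2 + l₁ a + l₂ b + c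
  let G : ℍ[ℝ] → ℍ[ℝ] → ℍ[ℝ] := fun a b => b * star a + M₁ a + M₂ b + d
  have hne (a b : ℍ[ℝ]) (hG : G a b = 0) : h a b ≠ 0 := fun h0 => hno a b h0 hG
  have hl₁ := norm_nonneg l₁
  have hl₂ := norm_nonneg l₂
  have hc := abs_nonneg c
  have hl₁' (a : ℍ[ℝ]) : |l₁ a| ≤ ‖l₁‖ * ‖a‖ := l₁.le_opNorm a
  have hl₂' (b : ℍ[ℝ]) : |l₂ b| ≤ ‖l₂‖ * ‖b‖ := l₂.le_opNorm b
  have hcont : Continuous fun p : ℍ[ℝ] × ℍ[ℝ] => h p.1 p.2 := by fun_prop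
  have Gcont : Continuous fun p : ℍ[ℝ] × ℍ[ℝ] => G p.1 p.2 := by fun_prop
  let starL : ℍ[ℝ] →L[ℝ] ℍ[ℝ] :=
    { toFun := star
      map_add' := star_add
      map_smul' := fun r a => Quaternion.star_smul r a }
  have hstarL (a : ℍ[ℝ]) : starL a = star a := rfl
  let T : ℍ[ℝ] → (ℍ[ℝ] →L[ℝ] ℍ[ℝ]) := fun b => (ContinuousLinearMap.mul ℝ ℍ[ℝ] b).comp starL + M₁
  have hT (a b : ℍ[ℝ]) : T b a = b * star a + M₁ a := rfl
  have Tcont : Continuous T := by fun_prop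
  have hGT (a b : ℍ[ℝ]) : G a b = 0 ↔ T b a = -(M₂ b + d) := by
    rw [hT, eq_neg_iff_add_eq_zero, ← add_assoc]
  let U : Set ℍ[ℝ] := {b | ∃ a, G a b = 0 ∧ h a b ≤ 0}
  have bound {a b : ℍ[ℝ]} (hab : h a b ≤ 0) :
      ‖a‖ ≤ ‖l₁‖ + 1 + (κ * ‖b‖ ^ 2 + ‖l₂‖ * ‖b‖ + |c|) := by
    have e1 := neg_le_of_abs_le (hl₁' a)
    have e2 := neg_le_of_abs_le (hl₂' b)
    have e3 := neg_abs_le c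
    have hD : 0 ≤ κ * ‖b‖ ^ 2 + ‖l₂‖ * ‖b‖ + |c| := by positivity
    simp only [h] at hab
    by_contra! h1
    nlinarith
  have inj {a b : ℍ[ℝ]} (hG : G a b = 0) (hab : h a b ≤ 0) : Function.Injective (T b) := by
    rw [injective_iff_map_eq_zero]
    intro k hk
    by_contra hk0
    have hGr (r : ℝ) : G (a + r • k) b = 0 := by
      rw [hGT, map_add, map_smul, hk, smul_zero, add_zero, ← hGT, hG]
    have hlarge : ∃ r : ℝ, 0 < h (a + r • k) b := by
      by_contra! hle
      obtain ⟨D, hDdef⟩ : ∃ D, D = ‖l₁‖ + 1 + (κ * ‖b‖ ^ 2 + ‖l₂‖ * ‖b‖ + |c|) := ⟨_, rfl⟩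
      have hkpos : 0 < ‖k‖ := norm_pos_iff.2 hk0
      have hD : 0 ≤ D := by rw [hDdef]; positivity
      obtain ⟨r, hrdef⟩ : ∃ r, r = (D + ‖a‖ + 1) / ‖k‖ := ⟨_, rfl⟩
      have h1 := bound (hle r)
      rw [← hDdef] at h1
      have h2 := norm_sub_le (a + r • k) a
      have hr : 0 ≤ r := by rw [hrdef]; positivity
      rw [add_sub_cancel_left, norm_smul, Real.norm_of_nonneg hr,
        (eq_div_iff hkpos.ne').1 hrdef] at h2
      linarith
    obtain ⟨r, hr⟩ := hlarge
    have hcr : Continuous fun s : ℝ => h (a + s • k) b := by fun_prop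
    obtain ⟨s, hs⟩ := mem_range_of_exists_le_of_exists_ge hcr ⟨0, by simpa using hab⟩ ⟨r, hr.le⟩
    exact hne _ _ (hGr s) hs
  have Uclosed : IsClosed U := by
    apply IsSeqClosed.isClosed
    intro b b₀ hb hlim
    choose a hGa hha using hb
    obtain ⟨D, hD⟩ : ∃ D, ∀ m, ‖b m‖ ≤ D := by
      obtain ⟨D, hD⟩ := (Metric.isBounded_range_of_tendsto b hlim).exists_norm_le
      exact ⟨D, fun m => hD _ ⟨m, rfl⟩⟩
    have ha (m : ℕ) : a m ∈ Metric.closedBall (0 : ℍ[ℝ])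
        (‖l₁‖ + 1 + (κ * D ^ 2 + ‖l₂‖ * D + |c|)) := by
      rw [mem_closedBall_zero_iff]
      refine (bound (hha m)).trans ?_
      gcongr <;> exact hD m
    obtain ⟨a₀, -, φ, hφ, hφlim⟩ := (isCompact_closedBall _ _).tendsto_subseq ha
    have hp := hφlim.prodMk_nhds (hlim.comp hφ.tendsto_atTop)
    have hGlim := (Gcont.tendsto (a₀, b₀)).comp hp
    have hhlim := (hcont.tendsto (a₀, b₀)).comp hp
    refine ⟨a₀, ?_, le_of_tendsto hhlim (.of_forall fun m => hha (φ m))⟩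
    refine tendsto_nhds_unique hGlim (tendsto_const_nhds.congr fun m => ?_)
    exact (hGa (φ m)).symm
  have Uopen : IsOpen U := by
    rw [isOpen_iff_mem_nhds]
    rintro b ⟨a, hG, hab⟩
    obtain ⟨sol, solcont, hsol⟩ := exists_continuousAt_solution (f := fun b' => -(M₂ b' + d))
      (Tcont.continuousAt (x := b)) (by fun_prop) (inj hG hab)
    have hsolb : sol b = a := inj hG hab (hsol.self_of_nhds.trans ((hGT a b).1 hG).symm)
    have hhcont : ContinuousAt (fun b' => h (sol b') b') b := by fun_prop
    have hneg : h (sol b) b < 0 := hsolb ▸ lt_of_le_of_ne hab (hne a b hG)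
    filter_upwards [hsol, hhcont.eventually (gt_mem_nhds hneg)] with b' hb' hlt
    exact ⟨sol b', (hGT _ _).2 hb', hlt.le⟩
  have Unonempty : U.Nonempty := by
    obtain ⟨C, R₀, hC, hR⟩ := exists_bounded_zero_of_large_smul (M₁.comp starL) (M₂ 1) d
    set γ := C ^ 2 + ‖l₁‖ * C + |c|
    have hγ : 0 ≤ γ := by positivity
    set R := max R₀ 1 + (‖l₂‖ + γ) / κ
    have hq : 0 ≤ (‖l₂‖ + γ) / κ := by positivity
    have hR1 : 1 ≤ R := by linarith [le_max_right R₀ 1]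
    have hR2 : ‖l₂‖ + γ ≤ κ * R := by
      rw [← div_le_iff₀' hκ]; linarith [le_max_right R₀ 1]
    obtain ⟨u, hu, huC⟩ := hR R (by linarith [le_max_left R₀ 1])
    refine ⟨R • 1, star u, ?_, ?_⟩
    · simpa [G, hstarL] using hu
    · have hn : ‖R • (1 : ℍ[ℝ])‖ = R := by
        rw [norm_smul, norm_one, mul_one, Real.norm_of_nonneg (by linarith)]
      have e1 := le_of_abs_le (hl₁' (star u))
      have e2 := le_of_abs_le (hl₂' (R • 1))
      simp only [h]
      rw [hn] at e2 ⊢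
      rw [norm_star] at e1 ⊢
      have e3 : ‖l₁‖ * ‖u‖ ≤ ‖l₁‖ * C := by gcongr
      have e4 : ‖u‖ ^ 2 ≤ C ^ 2 := by gcongr
      have e5 := le_abs_self c
      nlinarith
  obtain ⟨a₁, b₁, hG₁, hh₁⟩ : ∃ a b, G a b = 0 ∧ 0 < h a b := by
    obtain ⟨C, R₀, hC, hR⟩ := exists_bounded_zero_of_large_smul M₂ (M₁ 1) d
    set γ := κ * C ^ 2 + ‖l₂‖ * C + |c|
    have hγ : 0 ≤ γ := by positivity
    set R := max R₀ 1 + (‖l₁‖ + γ)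
    have hR1 : 1 ≤ R := by linarith [le_max_right R₀ 1]
    have hR2 : ‖l₁‖ + γ + 1 ≤ R := by linarith [le_max_right R₀ 1]
    obtain ⟨u, hu, huC⟩ := hR R (by linarith [le_max_left R₀ 1])
    refine ⟨R • 1, u, ?_, ?_⟩
    · rw [← hu]
      simp only [G, map_smul, Quaternion.star_smul, star_one, mul_smul_comm, mul_one]
      abel
    · have hn : ‖R • (1 : ℍ[ℝ])‖ = R := by
        rw [norm_smul, norm_one, mul_one, Real.norm_of_nonneg (by linarith)]
      have e1 := neg_le_of_abs_le (hl₁' (R • 1))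
      have e2 := neg_le_of_abs_le (hl₂' u)
      simp only [h]
      rw [hn] at e1 ⊢
      have e3 : ‖l₂‖ * ‖u‖ ≤ ‖l₂‖ * C := by gcongr
      have e4 : κ * ‖u‖ ^ 2 ≤ κ * C ^ 2 := by gcongr
      have e5 := neg_abs_le c
      nlinarith
  have hU : U = Set.univ := IsClopen.eq_univ ⟨Uclosed, Uopen⟩ Unonempty
  obtain ⟨a, hG, hab⟩ : b₁ ∈ U := hU ▸ Set.mem_univ b₁
  have : a = a₁ := inj hG hab (((hGT _ _).1 hG).trans ((hGT _ _).1 hG₁).symm)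
  subst this
  linarith

/-- The real part of the sesquilinear form `xᴴ A y`, as a real bilinear form. -/
noncomputable def reForm {n : ℕ} (A : Matrix (Fin n) (Fin n) ℍ[ℝ]) :
    (Fin n → ℍ[ℝ]) →ₗ[ℝ] (Fin n → ℍ[ℝ]) →ₗ[ℝ] ℝ :=
  LinearMap.mk₂ ℝ (fun x y => (star x ⬝ᵥ A *ᵥ y).re)
    (fun x x' y => by simp [add_dotProduct])
    (fun r x y => by
      have : star (r • x) = r • star x := by ext1 i; simp
      rw [this, smul_dotProduct]; simp)
    (fun x y y' => by simp [mulVec_add, dotProduct_add])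
    (fun r x y => by simp [mulVec_smul, dotProduct_smul])

lemma reForm_apply {n : ℕ} (A : Matrix (Fin n) (Fin n) ℍ[ℝ]) (x y : Fin n → ℍ[ℝ]) :
    reForm A x y = (star x ⬝ᵥ A *ᵥ y).re := rfl

lemma star_qform_comm {n : ℕ} {A : Matrix (Fin n) (Fin n) ℍ[ℝ]} (hA : A.IsHermitian)
    (x y : Fin n → ℍ[ℝ]) : star (star x ⬝ᵥ A *ᵥ y) = star y ⬝ᵥ A *ᵥ x := by
  rw [star_dotProduct, star_mulVec, hA.eq, dotProduct_mulVec, star_star]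

lemma reForm_comm {n : ℕ} {A : Matrix (Fin n) (Fin n) ℍ[ℝ]} (hA : A.IsHermitian)
    (x y : Fin n → ℍ[ℝ]) : reForm A x y = reForm A y x := by
  rw [reForm_apply, reForm_apply, ← star_qform_comm hA x y, Quaternion.re_star]

lemma qform_eq_coe_reForm {n : ℕ} {A : Matrix (Fin n) (Fin n) ℍ[ℝ]} (hA : A.IsHermitian)
    (x : Fin n → ℍ[ℝ]) : qform A x = ((reForm A x x : ℝ) : ℍ[ℝ]) :=
  Quaternion.star_eq_self.mp (star_qform_comm hA x x)

/-- Right multiplication of a vector by quaternions. -/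
noncomputable def vecMulRight {n : ℕ} (x : Fin n → ℍ[ℝ]) : ℍ[ℝ] →ₗ[ℝ] (Fin n → ℍ[ℝ]) where
  toFun a i := x i * a
  map_add' a b := by ext1 i; simp [mul_add]
  map_smul' r a := by ext1 i; simp

lemma reForm_vecMulRight {n : ℕ} (A : Matrix (Fin n) (Fin n) ℍ[ℝ]) (x y : Fin n → ℍ[ℝ])
    (a b : ℍ[ℝ]) :
    reForm A (vecMulRight x a) (vecMulRight y b) = ((star x ⬝ᵥ A *ᵥ y) * (b * star a)).re := by
  have key : star (vecMulRight x a) ⬝ᵥ A *ᵥ (vecMulRight y b)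
      = star a * ((star x ⬝ᵥ A *ᵥ y) * b) := by
    simp [vecMulRight, dotProduct, mulVec, Finset.mul_sum, Finset.sum_mul, mul_assoc]
  rw [reForm_apply, key, ← mul_assoc (star x ⬝ᵥ A *ᵥ y)]
  simp only [Quaternion.re_mul]
  ring

lemma reForm_vecMulRight_self {n : ℕ} (A : Matrix (Fin n) (Fin n) ℍ[ℝ]) (x : Fin n → ℍ[ℝ])
    (a : ℍ[ℝ]) : reForm A (vecMulRight x a) (vecMulRight x a) = ‖a‖ ^ 2 * reForm A x x := by
  rw [reForm_vecMulRight, Quaternion.self_mul_star, Quaternion.normSq_eq_norm_mul_self,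
    reForm_apply, ← Quaternion.coe_commutes, Quaternion.coe_mul_eq_smul, Quaternion.re_smul,
    smul_eq_mul, sq]

/-- Five quaternion Hermitian forms that are balanced at two vectors have a common nontrivial
zero in dimension at least three. -/
lemma exists_common_zero_of_balanced {n : ℕ} (hn : 3 ≤ n)
    (A : Fin 5 → Matrix (Fin n) (Fin n) ℍ[ℝ]) (hA : ∀ k, (A k).IsHermitian)
    {κ : ℝ} (hκ : 0 < κ) {x y : Fin n → ℍ[ℝ]} (hx : x ≠ 0)
    (hxy : ∀ k, reForm (A k) y y = -κ * reForm (A k) x x) :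
    ∃ z : Fin n → ℍ[ℝ], z ≠ 0 ∧ ∀ k, reForm (A k) z z = 0 := by
  by_cases hx0 : ∀ k, reForm (A k) x x = 0
  · exact ⟨x, hx, hx0⟩
  let Φ : (ℝ × ℍ[ℝ]) →ₗ[ℝ] (Fin 5 → ℝ) :=
    { toFun := fun p k => p.1 * reForm (A k) x x + 2 * ((star x ⬝ᵥ A k *ᵥ y) * p.2).re
      map_add' := fun p q => by ext k; simp [mul_add, add_mul]; ring
      map_smul' := fun r p => by ext k; simp; ring }
  have hΦ (p : ℝ × ℍ[ℝ]) (k : Fin 5) :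
      Φ p k = p.1 * reForm (A k) x x + 2 * ((star x ⬝ᵥ A k *ᵥ y) * p.2).re := rfl
  have hpair (a b : ℍ[ℝ]) (k : Fin 5) :
      reForm (A k) (vecMulRight x a + vecMulRight y b) (vecMulRight x a + vecMulRight y b)
        = Φ (‖a‖ ^ 2 - κ * ‖b‖ ^ 2, b * star a) k := by
    simp only [map_add, LinearMap.add_apply, reForm_vecMulRight_self]
    rw [reForm_comm (hA k) (vecMulRight y b), reForm_vecMulRight, hxy, hΦ]
    ring
  by_cases hinj : Function.Injective Φ
  · let L : (ℍ[ℝ] × ℍ[ℝ]) →ₗ[ℝ] (Fin n → ℍ[ℝ]) := (vecMulRight x).coprod (vecMulRight y)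
    obtain ⟨w, hw⟩ : ∃ w, ∀ p, L p ≠ w := by
      by_contra! hsurj
      have h := LinearMap.finrank_le_finrank_of_surjective (f := L) hsurj
      rw [Module.finrank_pi_fintype, Module.finrank_prod] at h
      simp [Quaternion.finrank_eq_four] at h
      omega
    let e : (ℝ × ℍ[ℝ]) ≃ₗ[ℝ] (Fin 5 → ℝ) := Φ.linearEquivOfInjective hinj (by
      simp [Module.finrank_prod, Quaternion.finrank_eq_four])
    have he (p : ℝ × ℍ[ℝ]) : e p = Φ p := rfl
    let cross (v : Fin n → ℍ[ℝ]) : ℍ[ℝ] →ₗ[ℝ] (ℝ × ℍ[ℝ]) :=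
      e.symm.toLinearMap ∘ₗ LinearMap.pi fun k => (2 : ℝ) • (reForm (A k)).flip w ∘ₗ vecMulRight v
    have hcross (v : Fin n → ℍ[ℝ]) (a : ℍ[ℝ]) (k : Fin 5) :
        Φ (cross v a) k = 2 * reForm (A k) (vecMulRight v a) w := by
      rw [← he]
      simp [cross]
    let const : ℝ × ℍ[ℝ] := e.symm fun k => reForm (A k) w w
    have hconst (k : Fin 5) : Φ const k = reForm (A k) w w := by
      rw [← he]
      simp [const]
    obtain ⟨a, b, h1, h2⟩ := exists_zero_of_hopf_leading_part hκ
      (LinearMap.fst ℝ ℝ ℍ[ℝ] ∘ₗ cross x).toContinuousLinearMap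
      (LinearMap.fst ℝ ℝ ℍ[ℝ] ∘ₗ cross y).toContinuousLinearMap const.1
      (LinearMap.snd ℝ ℝ ℍ[ℝ] ∘ₗ cross x).toContinuousLinearMap
      (LinearMap.snd ℝ ℝ ℍ[ℝ] ∘ₗ cross y).toContinuousLinearMap const.2
    have hzero : (‖a‖ ^ 2 - κ * ‖b‖ ^ 2, b * star a) + cross x a + cross y b + const = 0 :=
      Prod.ext h1 h2
    refine ⟨vecMulRight x a + vecMulRight y b + w, fun h0 => hw (-a, -b) ?_, fun k => ?_⟩
    · simp only [L, LinearMap.coprod_apply, map_neg]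
      rw [← neg_add, neg_eq_iff_add_eq_zero, h0]
    · have h3 := congrFun (congrArg Φ hzero) k
      simp only [map_add, Pi.add_apply, hcross, hconst, ← hpair, map_zero, Pi.zero_apply] at h3
      simp only [map_add, LinearMap.add_apply] at h3 ⊢
      rw [reForm_comm (hA k) w (vecMulRight x a), reForm_comm (hA k) w (vecMulRight y b)]
      linarith
  · rw [injective_iff_map_eq_zero] at hinj
    push Not at hinj
    obtain ⟨⟨r, q⟩, hrq, hne⟩ := hinj
    have hq : q ≠ 0 := by
      rintro rfl
      refine hx0 fun k => ?_
      have h := congrFun hrq k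
      rw [hΦ] at h
      have hr : r ≠ 0 := by rintro rfl; exact hne rfl
      simpa [hr] using h
    have hqpos : 0 < ‖q‖ ^ 2 := by positivity
    obtain ⟨s, hs⟩ : ∃ s : ℝ, ‖q‖ ^ 2 * (s * s) + (-r) * s + (-κ) = 0 := by
      refine exists_quadratic_eq_zero hqpos.ne' ⟨√(discrim (‖q‖ ^ 2) (-r) (-κ)), ?_⟩
      rw [Real.mul_self_sqrt]
      rw [discrim]
      nlinarith [mul_pos hqpos hκ, sq_nonneg r]
    have hz (k : Fin 5) := hpair (s • star q) 1 k
    have hp : (‖s • star q‖ ^ 2 - κ * ‖(1 : ℍ[ℝ])‖ ^ 2, 1 * star (s • star q))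
        = s • ((r, q) : ℝ × ℍ[ℝ]) := by
      refine Prod.ext ?_ ?_
      · simp [norm_smul, mul_pow]
        linarith
      · simp
    rw [hp, Φ.map_smul, hrq] at hz
    refine ⟨_, fun h0 => hx0 fun k => ?_, fun k => (hz k).trans (by simp)⟩
    have hy : y = vecMulRight x (-(s • star q)) := by
      have : y = vecMulRight y 1 := by ext1 i; simp [vecMulRight]
      rw [map_neg, this, eq_neg_iff_add_eq_zero, add_comm, h0]
    have h1 := hxy k
    rw [hy, reForm_vecMulRight_self] at h1
    have h2 : (‖-(s • star q)‖ ^ 2 + κ) * reForm (A k) x x = 0 := by linarith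
    exact (mul_eq_zero.1 h2).resolve_left (by positivity)

lemma star_dotProduct_self_eq_coe_reForm {n : ℕ} (x : Fin n → ℍ[ℝ]) :
    star x ⬝ᵥ x = ((reForm 1 x x : ℝ) : ℍ[ℝ]) := by
  rw [← qform_eq_coe_reForm isHermitian_one, qform, one_mulVec]

lemma reForm_one_self_pos {n : ℕ} {x : Fin n → ℍ[ℝ]} (hx : x ≠ 0) : 0 < reForm 1 x x := by
  have h : reForm 1 x x = ∑ i, ‖x i‖ ^ 2 := by
    rw [reForm_apply, one_mulVec, dotProduct]
    have : ∀ s : Finset (Fin n), (∑ i ∈ s, star x i * x i).re = ∑ i ∈ s, ‖x i‖ ^ 2 := by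
      intro s
      induction s using Finset.cons_induction with
      | empty => simp
      | cons i s hi ih =>
        rw [Finset.sum_cons, Finset.sum_cons, Quaternion.re_add, ih, Pi.star_apply,
          Quaternion.star_mul_self, Quaternion.re_coe, Quaternion.normSq_eq_norm_mul_self, sq]
    exact this _
  obtain ⟨i, hi⟩ := Function.ne_iff.1 hx
  rw [h]
  exact Finset.sum_pos' (fun i _ => by positivity)
    ⟨i, Finset.mem_univ i, pow_pos (norm_pos_iff.2 hi) 2⟩

lemma reForm_sub_smul_one {n : ℕ} (A : Matrix (Fin n) (Fin n) ℍ[ℝ]) (c : ℝ)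
    (x : Fin n → ℍ[ℝ]) : reForm (A - c • 1) x x = reForm A x x - c * reForm 1 x x := by
  simp [reForm_apply, sub_mulVec, dotProduct_sub, smul_mulVec, dotProduct_smul]

/-- Au-Yeung–Poon: for n ≠ 2 the joint numerical range (on the unit sphere) of
five quaternion Hermitian matrices is a convex subset of ℝ⁵. -/
theorem joint_numerical_range_unit_sphere_convex {n : ℕ} (hn : 0 < n) (hn2 : n ≠ 2)
    (A : Fin 5 → Matrix (Fin n) (Fin n) ℍ[ℝ]) (hA : ∀ k, (A k).IsHermitian) :
    Convex ℝ {y : Fin 5 → ℝ |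
      ∃ x : Fin n → ℍ[ℝ], star x ⬝ᵥ x = 1 ∧
        ∀ k, ((y k : ℝ) : ℍ[ℝ]) = qform (A k) x} := by
  simp only [star_dotProduct_self_eq_coe_reForm, qform_eq_coe_reForm (hA _),
    Quaternion.coe_inj, ← Quaternion.coe_one]
  rw [convex_iff_forall_pos]
  rintro u ⟨x, hx, hu⟩ v ⟨y, hy, hv⟩ α β hα hβ hαβ
  have ne_zero_of_unit {w : Fin n → ℍ[ℝ]} (hw : reForm 1 w w = 1) : w ≠ 0 := by
    rintro rfl
    simp at hw
  suffices ∃ z : Fin n → ℍ[ℝ], z ≠ 0 ∧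
      ∀ k, reForm (A k) z z = (α * u k + β * v k) * reForm 1 z z by
    obtain ⟨z, hz, hzA⟩ := this
    have hpos := reForm_one_self_pos hz
    set N := reForm 1 z z
    have hN : (√N)⁻¹ * ((√N)⁻¹ * N) = 1 := by
      rw [← mul_assoc, ← mul_inv, Real.mul_self_sqrt hpos.le, inv_mul_cancel₀ hpos.ne']
    refine ⟨(√N)⁻¹ • z, by simpa using hN, fun k => ?_⟩
    simp only [map_smul, LinearMap.smul_apply, smul_eq_mul, hzA, Pi.add_apply, Pi.smul_apply]
    linear_combination -(α * u k + β * v k) * hN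
  rcases (by omega : n = 1 ∨ 3 ≤ n) with rfl | hn3
  · have hxy : y = vecMulRight x ((x 0)⁻¹ * y 0) := by
      have hx0 : x 0 ≠ 0 := fun h0 => ne_zero_of_unit hx (by ext1 i; rwa [Fin.fin_one_eq_zero i])
      ext1 i
      rw [Fin.fin_one_eq_zero i]
      simp [vecMulRight, hx0]
    rw [hxy, reForm_vecMulRight_self, hx, mul_one] at hy
    refine ⟨x, ne_zero_of_unit hx, fun k => ?_⟩
    rw [hu, hv, hxy, reForm_vecMulRight_self, hy, hx]
    linear_combination (-reForm (A k) x x) * hαβ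
  · obtain ⟨z, hz, hzA⟩ := exists_common_zero_of_balanced hn3
      (fun k => A k - (α * u k + β * v k) • 1)
      (fun k => (hA k).sub (by
        ext1 i j
        rw [conjTranspose_apply, Matrix.smul_apply, Matrix.smul_apply, Quaternion.star_smul,
          ← conjTranspose_apply, conjTranspose_one]))
      (div_pos hα hβ) (x := x) (y := y) (ne_zero_of_unit hx) (fun k => by
        rw [reForm_sub_smul_one, reForm_sub_smul_one, hx, hy, ← hu, ← hv]
        field_simp
        linear_combination (-(α * u k + β * v k)) * hαβ)
    refine ⟨z, hz, fun k => ?_⟩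
    have h := hzA k
    rw [reForm_sub_smul_one] at h
    linarith
end

section
/- Let A_1, A_2 be n×n complex Hermitian matrices. Then the joint numerical range { (xᴴA_1x, xᴴA_2x) : x ∈ ℂⁿ, xᴴx = 1 } is a convex subset of ℝ². -/
open Matrix BigOperators

/-- The real part of the quadratic form `z ↦ zᴴAz`. -/
noncomputable def reQuadForm {n : ℕ} (A : Matrix (Fin n) (Fin n) ℂ) (z : Fin n → ℂ) : ℝ :=
  (star z ⬝ᵥ A *ᵥ z).re

theorem Matrix.IsHermitian.coe_reQuadForm {n : ℕ} {A : Matrix (Fin n) (Fin n) ℂ}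
    (hA : A.IsHermitian) (z : Fin n → ℂ) : (reQuadForm A z : ℂ) = star z ⬝ᵥ A *ᵥ z :=
  Complex.ext rfl (by simpa using (hA.im_star_dotProduct_mulVec_self z).symm)

theorem reQuadForm_smul {n : ℕ} (A : Matrix (Fin n) (Fin n) ℂ) (c : ℂ) (z : Fin n → ℂ) :
    reQuadForm A (c • z) = Complex.normSq c * reQuadForm A z := by
  have h : star (c • z) ⬝ᵥ A *ᵥ (c • z) = (Complex.normSq c : ℂ) * (star z ⬝ᵥ A *ᵥ z) := by
    rw [star_smul, mulVec_smul, smul_dotProduct, dotProduct_smul, Complex.normSq_eq_conj_mul_self]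
    simp [mul_assoc]
  rw [reQuadForm, h, Complex.re_ofReal_mul, reQuadForm]

theorem Matrix.IsHermitian.reQuadForm_add {n : ℕ} {A : Matrix (Fin n) (Fin n) ℂ}
    (hA : A.IsHermitian) (x y : Fin n → ℂ) :
    reQuadForm A (x + y) = reQuadForm A x + reQuadForm A y + 2 * (star x ⬝ᵥ A *ᵥ y).re := by
  have h : (star y ⬝ᵥ A *ᵥ x) = star (star x ⬝ᵥ A *ᵥ y) := by
    rw [star_dotProduct, star_mulVec, hA.eq, dotProduct_mulVec]
  simp only [reQuadForm, star_add, mulVec_add, add_dotProduct, dotProduct_add, h, Complex.add_re,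
    Complex.star_def, Complex.conj_re]
  ring

open scoped ComplexOrder in
theorem reQuadForm_one_pos {n : ℕ} {z : Fin n → ℂ} (hz : z ≠ 0) : 0 < reQuadForm 1 z := by
  have h := dotProduct_star_self_pos_iff.2 hz
  simpa [reQuadForm] using (Complex.lt_def.1 h).1

theorem continuous_reQuadForm {n : ℕ} (A : Matrix (Fin n) (Fin n) ℂ) :
    Continuous (reQuadForm A) := by
  unfold reQuadForm
  fun_prop

theorem exists_normSq_eq_one_re_mul_eq_zero (u : ℂ) :
    ∃ s : ℂ, Complex.normSq s = 1 ∧ (s * u).re = 0 := by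
  by_cases hu : u = 0
  · exact ⟨1, by simp [hu]⟩
  · have hn : Complex.normSq u ≠ 0 := by simpa using hu
    refine ⟨Complex.I * (star u / (‖u‖ : ℂ)), ?_, ?_⟩
    · simp [← Complex.normSq_eq_norm_sq, ← pow_two, hn]
    · have h : Complex.I * (star u / (‖u‖ : ℂ)) * u =
          ((Complex.normSq u / ‖u‖ : ℝ) : ℂ) * Complex.I := by
        push_cast
        rw [Complex.normSq_eq_conj_mul_self, Complex.star_def]
        ring
      rw [h, Complex.re_ofReal_mul]
      simp

/-- Two isotropic vectors of a Hermitian form can be joined, up to a phase, by a segment of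
isotropic vectors, along which a second form takes all intermediate values. -/
theorem exists_ne_zero_reQuadForm_eq_zero {n : ℕ} {A B : Matrix (Fin n) (Fin n) ℂ}
    (hA : A.IsHermitian) {x y : Fin n → ℂ} (hx : x ≠ 0) (hy : y ≠ 0)
    (hAx : reQuadForm A x = 0) (hAy : reQuadForm A y = 0)
    (hBx : reQuadForm B x ≤ 0) (hBy : 0 ≤ reQuadForm B y) :
    ∃ z ≠ 0, reQuadForm A z = 0 ∧ reQuadForm B z = 0 := by
  rcases hBx.eq_or_lt with hBx | hBx
  · exact ⟨x, hx, hAx, hBx⟩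
  rcases hBy.eq_or_lt with hBy | hBy
  · exact ⟨y, hy, hAy, hBy.symm⟩
  obtain ⟨s, hs, hsu⟩ := exists_normSq_eq_one_re_mul_eq_zero (star x ⬝ᵥ A *ᵥ y)
  let z : ℝ → Fin n → ℂ := fun τ => ((1 - τ : ℝ) : ℂ) • x + (τ : ℂ) • s • y
  have hz : Continuous z := by fun_prop
  have h0 : reQuadForm B (z 0) ≤ 0 := by simpa [z] using hBx.le
  have h1 : 0 ≤ reQuadForm B (z 1) := by simpa [z, reQuadForm_smul, hs] using hBy.le
  obtain ⟨τ, -, hτ⟩ := intermediate_value_Icc zero_le_one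
    ((continuous_reQuadForm B).comp hz).continuousOn ⟨h0, h1⟩
  refine ⟨z τ, fun h => ?_, ?_, hτ⟩
  · have h' := congrArg (reQuadForm B) (eq_neg_of_add_eq_zero_left h)
    rw [← neg_smul, reQuadForm_smul, reQuadForm_smul, reQuadForm_smul, hs, Complex.normSq_neg,
      Complex.normSq_ofReal, Complex.normSq_ofReal] at h'
    have hτ0 : τ = 0 := by
      have := mul_nonneg (mul_self_nonneg (1 - τ)) (neg_pos.2 hBx).le
      have h2 : τ * τ * reQuadForm B y = 0 :=
        le_antisymm (by linarith) (mul_nonneg (mul_self_nonneg τ) hBy.le)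
      simpa [hBy.ne'] using h2
    subst hτ0
    simp [hBx.ne] at h'
  · have hcross : star (((1 - τ : ℝ) : ℂ) • x) ⬝ᵥ A *ᵥ ((τ : ℂ) • s • y) =
        (((1 - τ) * τ : ℝ) : ℂ) * (s * (star x ⬝ᵥ A *ᵥ y)) := by
      rw [star_smul, mulVec_smul, mulVec_smul, smul_dotProduct, dotProduct_smul, dotProduct_smul,
        Complex.star_def, Complex.conj_ofReal]
      simp only [smul_eq_mul]
      push_cast
      ring
    simp only [z]
    rw [hA.reQuadForm_add, hcross, Complex.re_ofReal_mul, hsu]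
    simp only [reQuadForm_smul, hAx, hAy, mul_zero, add_zero]

theorem reQuadForm_lincomb {n : ℕ} (A₁ A₂ : Matrix (Fin n) (Fin n) ℂ) (a b c : ℝ)
    (z : Fin n → ℂ) :
    reQuadForm (a • A₁ + b • A₂ + c • 1) z =
      a * reQuadForm A₁ z + b * reQuadForm A₂ z + c * reQuadForm 1 z := by
  simp only [reQuadForm, add_mulVec, smul_mulVec, dotProduct_add, dotProduct_smul, Complex.add_re,
    Complex.smul_re, smul_eq_mul]

/-- Hausdorff–Toeplitz: the joint numerical range of two complex Hermitian
matrices on the unit sphere is a convex subset of ℝ². -/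
theorem joint_numerical_range_two_complex_convex {n : ℕ}
    (A₁ A₂ : Matrix (Fin n) (Fin n) ℂ)
    (h₁ : A₁.IsHermitian) (h₂ : A₂.IsHermitian) :
    Convex ℝ {p : ℝ × ℝ | ∃ x : Fin n → ℂ, star x ⬝ᵥ x = 1 ∧
      ((p.1 : ℝ) : ℂ) = star x ⬝ᵥ A₁.mulVec x ∧
      ((p.2 : ℝ) : ℂ) = star x ⬝ᵥ A₂.mulVec x} := by
  have h_one : (1 : Matrix (Fin n) (Fin n) ℂ).IsHermitian := isHermitian_one
  have h_mem (p : ℝ × ℝ) (x : Fin n → ℂ) : (star x ⬝ᵥ x = 1 ∧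
      ((p.1 : ℝ) : ℂ) = star x ⬝ᵥ A₁.mulVec x ∧ ((p.2 : ℝ) : ℂ) = star x ⬝ᵥ A₂.mulVec x) ↔
      reQuadForm 1 x = 1 ∧ p.1 = reQuadForm A₁ x ∧ p.2 = reQuadForm A₂ x := by
    rw [← h₁.coe_reQuadForm, ← h₂.coe_reQuadForm, Complex.ofReal_inj, Complex.ofReal_inj,
      ← Complex.ofReal_inj (z := reQuadForm 1 x), h_one.coe_reQuadForm, one_mulVec,
      Complex.ofReal_one]
  simp only [h_mem]
  rintro ⟨p₁, p₂⟩ ⟨x, hx, hx₁, hx₂⟩ ⟨q₁, q₂⟩ ⟨y, hy, hy₁, hy₂⟩ a b ha hb hab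
  dsimp only at hx₁ hx₂ hy₁ hy₂
  simp only [Set.mem_ofPred_eq, Prod.smul_mk, Prod.mk_add_mk, smul_eq_mul]
  obtain rfl : a = 1 - b := by linarith
  have hne {w : Fin n → ℂ} (hw : reQuadForm 1 w = 1) : w ≠ 0 := by
    rintro rfl
    simp [reQuadForm] at hw
  set d₁ := q₁ - p₁ with hd₁
  set d₂ := q₂ - p₂ with hd₂
  by_cases hd : d₁ ^ 2 + d₂ ^ 2 = 0
  · have e₁ : d₁ = 0 := by nlinarith [sq_nonneg d₁, sq_nonneg d₂]
    have e₂ : d₂ = 0 := by nlinarith [sq_nonneg d₁, sq_nonneg d₂]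
    refine ⟨x, hx, ?_, ?_⟩
    · linear_combination hx₁ + b * e₁ - b * hd₁
    · linear_combination hx₂ + b * e₂ - b * hd₂
  set r₁ := (1 - b) * p₁ + b * q₁ with hr₁
  set r₂ := (1 - b) * p₂ + b * q₂ with hr₂
  have hA : ((-d₂) • A₁ + d₁ • A₂ + (d₂ * r₁ - d₁ * r₂) • 1).IsHermitian :=
    ((h₁.smul (.all _)).add (h₂.smul (.all _))).add (h_one.smul (.all _))
  obtain ⟨z, hz, hzA, hzB⟩ := exists_ne_zero_reQuadForm_eq_zero
    (B := d₁ • A₁ + d₂ • A₂ + (-(d₁ * r₁ + d₂ * r₂)) • 1) hA (hne hx) (hne hy)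
    (by rw [reQuadForm_lincomb, hx, ← hx₁, ← hx₂, hr₁, hr₂, hd₁, hd₂]; ring)
    (by rw [reQuadForm_lincomb, hy, ← hy₁, ← hy₂, hr₁, hr₂, hd₁, hd₂]; ring)
    (by
      rw [reQuadForm_lincomb, hx, ← hx₁, ← hx₂, hr₁, hr₂]
      have : 0 ≤ b * (d₁ ^ 2 + d₂ ^ 2) := by positivity
      rw [hd₁, hd₂] at *
      linarith)
    (by
      rw [reQuadForm_lincomb, hy, ← hy₁, ← hy₂, hr₁, hr₂]
      have : 0 ≤ (1 - b) * (d₁ ^ 2 + d₂ ^ 2) := by positivity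
      rw [hd₁, hd₂] at *
      linarith)
  rw [reQuadForm_lincomb] at hzA hzB
  have hN := reQuadForm_one_pos hz
  have e₁ : reQuadForm A₁ z = r₁ * reQuadForm 1 z :=
    mul_left_cancel₀ hd (by linear_combination d₁ * hzB - d₂ * hzA)
  have e₂ : reQuadForm A₂ z = r₂ * reQuadForm 1 z :=
    mul_left_cancel₀ hd (by linear_combination d₂ * hzB + d₁ * hzA)
  have hc : Complex.normSq ((√(reQuadForm 1 z))⁻¹ : ℝ) * reQuadForm 1 z = 1 := by
    rw [Complex.normSq_ofReal, ← mul_inv, Real.mul_self_sqrt hN.le, inv_mul_cancel₀ hN.ne']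
  refine ⟨(((√(reQuadForm 1 z))⁻¹ : ℝ) : ℂ) • z, ?_, ?_, ?_⟩
  · rw [reQuadForm_smul, hc]
  · rw [reQuadForm_smul, e₁, mul_left_comm, hc, mul_one]
  · rw [reQuadForm_smul, e₂, mul_left_comm, hc, mul_one]
end

section
/- Let A_1, A_2, A_3 be n×n complex Hermitian matrices. Then the set { (xᴴA_1x, xᴴA_2x, xᴴA_3x) : x ∈ ℂⁿ } is a convex subset of ℝ³. -/
open Matrix BigOperators

/-- A nonzero `2 × 2` Hermitian matrix `H = [[p, w], [conj w, s]]` with `‖w‖² = q` can be scaled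
so that `1 + t • H` is positive semidefinite and singular. -/
lemma exists_one_add_smul_singular_of_nonneg {p s q : ℝ} (hq : 0 ≤ q)
    (h : p ≠ 0 ∨ s ≠ 0 ∨ q ≠ 0) (hps : 0 ≤ p + s) :
    ∃ t : ℝ, 0 ≤ 1 + t * p ∧ 0 ≤ 1 + t * s ∧ (1 + t * p) * (1 + t * s) = t ^ 2 * q := by
  have hD : 0 ≤ (p - s) ^ 2 + 4 * q := by positivity
  set r := √((p - s) ^ 2 + 4 * q)
  have hr0 : 0 ≤ r := Real.sqrt_nonneg _
  have hr2 : r ^ 2 = (p - s) ^ 2 + 4 * q := Real.sq_sqrt hD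
  have hrps : |p - s| ≤ r := Real.abs_le_sqrt (by linarith)
  obtain ⟨hsp, hps'⟩ := abs_le.1 hrps
  have hpos : 0 < p + s + r := by
    by_contra! hle
    have hr' : r = 0 := by linarith
    have hsum : p + s = 0 := by linarith
    rw [hr'] at hr2
    have hq' : q = 0 := by nlinarith [sq_nonneg (p - s)]
    have hdiff : p - s = 0 := by
      apply pow_eq_zero_iff two_ne_zero |>.1
      linarith
    rcases h with h | h | h
    · exact h (by linarith)
    · exact h (by linarith)
    · exact h hq'
  have key (a b : ℝ) (hab : a + b = p + s) :
      1 + -2 / (p + s + r) * a = (b - a + r) / (p + s + r) := by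
    rw [← hab] at hpos ⊢
    field_simp
    ring
  refine ⟨-2 / (p + s + r), ?_, ?_, ?_⟩
  · rw [key p s rfl]
    exact div_nonneg (by linarith) hpos.le
  · rw [key s p (add_comm _ _)]
    exact div_nonneg (by linarith) hpos.le
  · rw [key p s rfl, key s p (add_comm _ _)]
    field_simp
    linarith

lemma exists_one_add_smul_singular {p s q : ℝ} (hq : 0 ≤ q)
    (h : p ≠ 0 ∨ s ≠ 0 ∨ q ≠ 0) :
    ∃ t : ℝ, 0 ≤ 1 + t * p ∧ 0 ≤ 1 + t * s ∧ (1 + t * p) * (1 + t * s) = t ^ 2 * q := by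
  rcases le_total 0 (p + s) with hps | hps
  · exact exists_one_add_smul_singular_of_nonneg hq h hps
  · obtain ⟨t, h1, h2, h3⟩ := exists_one_add_smul_singular_of_nonneg (p := -p) (s := -s) hq
      (by simpa using h) (by linarith)
    exact ⟨-t, by linarith, by linarith, by linarith⟩

/-- A singular positive semidefinite `2 × 2` Hermitian matrix has rank at most one. -/
lemma exists_star_mul_eq_of_mul_eq_normSq {a b : ℝ} {w : ℂ} (ha : 0 ≤ a) (hb : 0 ≤ b)
    (h : a * b = Complex.normSq w) :
    ∃ α β : ℂ, star α * α = a ∧ star β * β = b ∧ star α * β = w := by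
  have hsqrt {c : ℝ} (hc : 0 ≤ c) : ((√c : ℝ) : ℂ) * (√c : ℝ) = c := by
    rw [← Complex.ofReal_mul, Real.mul_self_sqrt hc]
  rcases ha.eq_or_lt with rfl | ha'
  · have hw : w = 0 := Complex.normSq_eq_zero.1 (by linarith)
    exact ⟨0, (√b : ℝ), by simp, by simpa using hsqrt hb, by simp [hw]⟩
  · have hne : ((√a : ℝ) : ℂ) ≠ 0 := by
      exact_mod_cast (Real.sqrt_pos.2 ha').ne'
    have hne' : (a : ℂ) ≠ 0 := by exact_mod_cast ha'.ne'
    refine ⟨(√a : ℝ), w / (√a : ℝ), by simpa using hsqrt ha, ?_, ?_⟩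
    · have hw : (starRingEnd ℂ) w * w = a * b := by
        rw [mul_comm, Complex.mul_conj, ← h, Complex.ofReal_mul]
      simp only [star_div₀, RCLike.star_def, Complex.conj_ofReal]
      rw [div_mul_div_comm, hsqrt ha, hw]
      field_simp
    · simp only [RCLike.star_def, Complex.conj_ofReal]
      field_simp

/-- Three real linear equations on `2 × 2` Hermitian matrices `[[p, w], [conj w, s]]` have a
nontrivial common solution. -/
lemma exists_hermitian_two_ne_zero (P R : Fin 3 → ℝ) (c : Fin 3 → ℂ) :
    ∃ (p s : ℝ) (w : ℂ), (p ≠ 0 ∨ s ≠ 0 ∨ w ≠ 0) ∧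
      ∀ i, p * P i + s * R i + 2 * (w * c i).re = 0 := by
  let f : (ℝ × ℝ × ℂ) →ₗ[ℝ] (Fin 3 → ℝ) :=
    { toFun := fun v i => v.1 * P i + v.2.1 * R i + 2 * (v.2.2 * c i).re
      map_add' := fun v v' => by
        ext i
        simp only [Prod.fst_add, Prod.snd_add, Pi.add_apply, Complex.mul_re, Complex.add_re,
          Complex.add_im]
        ring
      map_smul' := fun r v => by
        ext i
        simp only [Prod.smul_fst, Prod.smul_snd, smul_eq_mul, Pi.smul_apply, Complex.mul_re,
          Complex.smul_re, Complex.smul_im, RingHom.id_apply]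
        ring }
  have hker : LinearMap.ker f ≠ ⊥ := LinearMap.ker_ne_bot_of_finrank_lt (by simp)
  obtain ⟨⟨p, s, w⟩, hv, hne⟩ := (Submodule.ne_bot_iff _).1 hker
  refine ⟨p, s, w, ?_, fun i => congrFun (LinearMap.mem_ker.1 hv) i⟩
  by_contra! hzero
  exact hne (by simp [hzero])

section QuadraticForm

variable {ι : Type*} [Fintype ι]

lemma Matrix.IsHermitian.star_star_dotProduct_mulVec {A : Matrix ι ι ℂ} (hA : A.IsHermitian)
    (u v : ι → ℂ) : star (star u ⬝ᵥ A *ᵥ v) = star v ⬝ᵥ A *ᵥ u := by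
  rw [star_dotProduct, star_star, star_mulVec, hA.eq, ← dotProduct_mulVec]

lemma star_smul_dotProduct_mulVec_smul (A : Matrix ι ι ℂ) (α β : ℂ) (u v : ι → ℂ) :
    star (α • u) ⬝ᵥ A *ᵥ (β • v) = star α * β * (star u ⬝ᵥ A *ᵥ v) := by
  rw [star_smul, mulVec_smul, smul_dotProduct, dotProduct_smul, smul_eq_mul, smul_eq_mul,
    mul_assoc]

/-- Sums of values of a triple of Hermitian forms are again values. -/
lemma exists_hermitian_forms_eq_add {A : Fin 3 → Matrix ι ι ℂ} (hA : ∀ i, (A i).IsHermitian)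
    (u v : ι → ℂ) :
    ∃ z : ι → ℂ, ∀ i,
      star z ⬝ᵥ A i *ᵥ z = star u ⬝ᵥ A i *ᵥ u + star v ⬝ᵥ A i *ᵥ v := by
  obtain ⟨p, s, w, hne, hzero⟩ := exists_hermitian_two_ne_zero
    (fun i => (star u ⬝ᵥ A i *ᵥ u).re) (fun i => (star v ⬝ᵥ A i *ᵥ v).re)
    (fun i => star u ⬝ᵥ A i *ᵥ v)
  obtain ⟨t, hp, hs, hdet⟩ := exists_one_add_smul_singular (Complex.normSq_nonneg w)
    (by simpa using hne)
  obtain ⟨α, β, hα, hβ, hαβ⟩ := exists_star_mul_eq_of_mul_eq_normSq (w := t * w) hp hs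
    (by rw [hdet, Complex.normSq_mul, Complex.normSq_ofReal, sq])
  have hβα : star β * α = star ((t : ℂ) * w) := by rw [← hαβ, star_mul, star_star]
  refine ⟨α • u + β • v, fun i => ?_⟩
  have hreal (x : ι → ℂ) : ((star x ⬝ᵥ A i *ᵥ x).re : ℂ) = star x ⬝ᵥ A i *ᵥ x :=
    Complex.conj_eq_iff_re.1 ((hA i).star_star_dotProduct_mulVec x x)
  have hcross : w * (star u ⬝ᵥ A i *ᵥ v) + star w * (star v ⬝ᵥ A i *ᵥ u) =
      ((2 * (w * (star u ⬝ᵥ A i *ᵥ v)).re : ℝ) : ℂ) := by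
    rw [← (hA i).star_star_dotProduct_mulVec u v, ← star_mul', ← Complex.add_conj]
    rfl
  have hsum := congrArg (fun r : ℝ => (r : ℂ)) (hzero i)
  simp only [Complex.ofReal_add, Complex.ofReal_mul p, Complex.ofReal_mul s, hreal,
    Complex.ofReal_zero, ← hcross] at hsum
  rw [star_add, mulVec_add, add_dotProduct, dotProduct_add, dotProduct_add]
  simp only [star_smul_dotProduct_mulVec_smul, hα, hβ, hαβ, hβα]
  simp only [star_mul', RCLike.star_def, Complex.conj_ofReal, Complex.ofReal_add,
    Complex.ofReal_one, Complex.ofReal_mul] at hsum ⊢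
  linear_combination (t : ℂ) * hsum

lemma star_sqrt_smul_dotProduct_mulVec (A : Matrix ι ι ℂ) {a : ℝ} (ha : 0 ≤ a) (x : ι → ℂ) :
    star (((√a : ℝ) : ℂ) • x) ⬝ᵥ A *ᵥ (((√a : ℝ) : ℂ) • x) = a * (star x ⬝ᵥ A *ᵥ x) := by
  rw [star_smul_dotProduct_mulVec_smul, RCLike.star_def, Complex.conj_ofReal,
    ← Complex.ofReal_mul, Real.mul_self_sqrt ha]

end QuadraticForm



/-- Brickman: the joint range (without the unit-sphere restriction) of three
complex Hermitian forms is a convex subset of ℝ³. -/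
theorem joint_range_three_complex_convex {n : ℕ}
    (A₁ A₂ A₃ : Matrix (Fin n) (Fin n) ℂ)
    (h₁ : A₁.IsHermitian) (h₂ : A₂.IsHermitian) (h₃ : A₃.IsHermitian) :
    Convex ℝ {y : Fin 3 → ℝ | ∃ x : Fin n → ℂ,
      ((y 0 : ℝ) : ℂ) = star x ⬝ᵥ A₁.mulVec x ∧
      ((y 1 : ℝ) : ℂ) = star x ⬝ᵥ A₂.mulVec x ∧
      ((y 2 : ℝ) : ℂ) = star x ⬝ᵥ A₃.mulVec x} := by
  rintro y ⟨x, hx₁, hx₂, hx₃⟩ y' ⟨x', hx'₁, hx'₂, hx'₃⟩ a b ha hb -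
  have hA : ∀ i, (![A₁, A₂, A₃] i).IsHermitian := by
    intro i
    fin_cases i <;> assumption
  obtain ⟨z, hz⟩ := exists_hermitian_forms_eq_add hA
    (((√a : ℝ) : ℂ) • x) (((√b : ℝ) : ℂ) • x')
  simp only [star_sqrt_smul_dotProduct_mulVec _ ha, star_sqrt_smul_dotProduct_mulVec _ hb] at hz
  refine ⟨z, ?_, ?_, ?_⟩
  · simpa [hx₁, hx'₁] using (hz 0).symm
  · simpa [hx₂, hx'₂] using (hz 1).symm
  · simpa [hx₃, hx'₃] using (hz 2).symm
end

section
/- Let A_0, A_1, A_2 be n×n complex Hermitian matrices and define the Hermitian forms F(x) = xᴴA_0x and G_i(x) = xᴴA_ix for i = 1, 2. Suppose (i) there exists x_0 ∈ ℂⁿ with G_1(x_0) > 0 and G_2(x_0) > 0, and (ii) for every x ∈ ℂⁿ, if G_1(x) ≥ 0 and G_2(x) ≥ 0 then F(x) ≥ 0. Then there exist real numbers τ_1, τ_2 ≥ 0 such that F(x) − τ_1G_1(x) − τ_2G_2(x) ≥ 0 for all x ∈ ℂⁿ (the S-procedure with two complex Hermitian form constraints is lossless). -/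
open Matrix BigOperators

/-- The real quadratic function `x ↦ Re (xᴴ A x)` attached to a complex matrix. -/
noncomputable def hermForm {ι : Type*} [Fintype ι] (A : Matrix ι ι ℂ) (x : ι → ℂ) : ℝ :=
  (star x ⬝ᵥ A.mulVec x).re

section hermForm

variable {ι : Type*} [Fintype ι]

theorem hermForm_smul (A : Matrix ι ι ℂ) (c : ℂ) (x : ι → ℂ) :
    hermForm A (c • x) = Complex.normSq c * hermForm A x := by
  have h : star (c • x) ⬝ᵥ A.mulVec (c • x)
      = (Complex.normSq c : ℂ) * (star x ⬝ᵥ A.mulVec x) := by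
    rw [star_smul, mulVec_smul, smul_dotProduct, dotProduct_smul, smul_eq_mul, smul_eq_mul,
      ← mul_assoc, Complex.normSq_eq_conj_mul_self]
    rfl
  rw [hermForm, h, Complex.re_ofReal_mul, hermForm]

theorem hermForm_add {A : Matrix ι ι ℂ} (hA : A.IsHermitian) (x y : ι → ℂ) :
    hermForm A (x + y) = hermForm A x + hermForm A y + 2 * (star x ⬝ᵥ A.mulVec y).re := by
  have h : star y ⬝ᵥ A.mulVec x = star (star x ⬝ᵥ A.mulVec y) := by
    rw [← star_dotProduct_star, star_star, star_mulVec, hA.eq, ← dotProduct_mulVec]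
  have h' : (star y ⬝ᵥ A.mulVec x).re = (star x ⬝ᵥ A.mulVec y).re := by
    rw [h, Complex.star_def, Complex.conj_re]
  simp only [hermForm, star_add, mulVec_add, add_dotProduct, dotProduct_add, Complex.add_re, h']
  ring

theorem hermForm_smul_add_smul {A : Matrix ι ι ℂ} (hA : A.IsHermitian) (a b : ℂ) (x y : ι → ℂ) :
    hermForm A (a • x + b • y) = Complex.normSq a * hermForm A x + Complex.normSq b * hermForm A y
      + 2 * (star a * b * (star x ⬝ᵥ A.mulVec y)).re := by
  rw [hermForm_add hA, hermForm_smul, hermForm_smul, star_smul, mulVec_smul, smul_dotProduct,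
    dotProduct_smul, smul_eq_mul, smul_eq_mul, mul_assoc]

end hermForm

/-- The line through the identity in the direction of a nonzero Hermitian `2 × 2` matrix
`!![p, w; conj w, q]` meets the boundary of the positive semidefinite cone. -/
theorem exists_one_add_mul_boundary {p q : ℝ} {w : ℂ} (h : (p, q, w) ≠ 0) :
    ∃ t : ℝ, 0 ≤ 1 + t * p ∧ 0 ≤ 1 + t * q ∧
      (1 + t * p) * (1 + t * q) = Complex.normSq (t * w) := by
  wlog hpq : p + q ≤ 0 generalizing p q w
  · obtain ⟨t, h1, h2, h3⟩ := this (p := -p) (q := -q) (w := -w)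
      (by simpa [Prod.ext_iff] using h) (by linarith)
    refine ⟨-t, by linarith, by linarith, ?_⟩
    have e : ((-t : ℝ) : ℂ) * w = t * -w := by push_cast; ring
    rw [e, ← h3]
    ring
  set N := Complex.normSq w with hN
  have hN0 : 0 ≤ N := Complex.normSq_nonneg w
  set s := √((p - q) ^ 2 + 4 * N) with hs
  have hs0 : 0 ≤ s := Real.sqrt_nonneg _
  have hs2 : s ^ 2 = (p - q) ^ 2 + 4 * N := Real.sq_sqrt (by positivity)
  have habs : |p - q| ≤ s := abs_le_of_sq_le_sq (by linarith) hs0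
  obtain ⟨ha, hb⟩ := abs_le.mp habs
  -- `-m` is the smaller eigenvalue
  obtain ⟨m, hm⟩ : ∃ m, m = (s - (p + q)) / 2 := ⟨_, rfl⟩
  have hmpos : 0 < m := by
    by_contra hcon
    have hs' : s = 0 := by linarith
    have hsum : p + q = 0 := by linarith
    rw [hs'] at hs2
    have hd : p - q = 0 := by nlinarith [sq_nonneg (p - q)]
    have hN' : N = 0 := by nlinarith [sq_nonneg (p - q)]
    apply h
    have hw : w = 0 := Complex.normSq_eq_zero.mp hN'
    have hp : p = 0 := by linarith
    have hq : q = 0 := by linarith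
    simp [hp, hq, hw]
  have hdet : (m + p) * (m + q) = N := by
    rw [hm]
    linear_combination hs2 / 4
  refine ⟨m⁻¹, ?_, ?_, ?_⟩
  · have : 1 + m⁻¹ * p = m⁻¹ * (m + p) := by field_simp
    rw [this]
    exact mul_nonneg (by positivity) (by linarith)
  · have : 1 + m⁻¹ * q = m⁻¹ * (m + q) := by field_simp
    rw [this]
    exact mul_nonneg (by positivity) (by linarith)
  · rw [Complex.normSq_mul, Complex.normSq_ofReal, ← hN, ← hdet]
    field_simp

/-- A singular positive semidefinite `2 × 2` matrix has rank at most one. -/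
theorem exists_normSq_eq_of_mul_eq_normSq {P Q : ℝ} {W : ℂ} (hP : 0 ≤ P) (hQ : 0 ≤ Q)
    (h : P * Q = Complex.normSq W) :
    ∃ a b : ℂ, Complex.normSq a = P ∧ Complex.normSq b = Q ∧ star a * b = W := by
  rcases hP.eq_or_lt with rfl | hP
  · have hW : W = 0 := by rw [← Complex.normSq_eq_zero, ← h, zero_mul]
    exact ⟨0, (√Q : ℝ), by simp, by rw [Complex.normSq_ofReal, Real.mul_self_sqrt hQ],
      by simp [hW]⟩
  · have hne : ((√P : ℝ) : ℂ) ≠ 0 := by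
      exact_mod_cast (Real.sqrt_pos.mpr hP).ne'
    refine ⟨(√P : ℝ), W / (√P : ℝ), ?_, ?_, ?_⟩
    · rw [Complex.normSq_ofReal, Real.mul_self_sqrt hP.le]
    · rw [Complex.normSq_div, Complex.normSq_ofReal, Real.mul_self_sqrt hP.le, ← h]
      field_simp
    · rw [Complex.star_def, Complex.conj_ofReal]
      field_simp

/-- Three real-linear equations on Hermitian `2 × 2` matrices have a nonzero solution. -/
theorem exists_ne_zero_three_equations (a b : Fin 3 → ℝ) (c : Fin 3 → ℂ) :
    ∃ (p q : ℝ) (w : ℂ), (p, q, w) ≠ 0 ∧ ∀ i, p * a i + q * b i + 2 * (w * c i).re = 0 := by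
  let L : ℝ × ℝ × ℂ →ₗ[ℝ] (Fin 3 → ℝ) :=
    { toFun := fun v i => v.1 * a i + v.2.1 * b i + 2 * (v.2.2 * c i).re
      map_add' := fun u v => by
        funext i
        simp only [Prod.fst_add, Prod.snd_add, add_mul, Complex.add_re, Pi.add_apply]
        ring
      map_smul' := fun r v => by
        funext i
        simp only [Prod.smul_fst, Prod.smul_snd, smul_mul_assoc, Complex.smul_re, smul_eq_mul,
          Pi.smul_apply, RingHom.id_apply]
        ring }
  have hL : L.ker ≠ ⊥ := LinearMap.ker_ne_bot_of_finrank_lt (by simp)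
  obtain ⟨⟨p, q, w⟩, hv, hne⟩ := Submodule.exists_mem_ne_zero_of_ne_bot hL
  exact ⟨p, q, w, hne, fun i => congrFun (LinearMap.mem_ker.mp hv) i⟩

section jointRange

variable {ι : Type*} [Fintype ι]

/-- The joint range of three Hermitian forms is closed under addition. -/
theorem exists_hermForm_eq_add {A : Fin 3 → Matrix ι ι ℂ} (hA : ∀ i, (A i).IsHermitian)
    (x y : ι → ℂ) : ∃ z, ∀ i, hermForm (A i) z = hermForm (A i) x + hermForm (A i) y := by
  obtain ⟨p, q, w, hne, heq⟩ := exists_ne_zero_three_equations (fun i => hermForm (A i) x)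
    (fun i => hermForm (A i) y) (fun i => star x ⬝ᵥ (A i).mulVec y)
  obtain ⟨t, hp, hq, hdet⟩ := exists_one_add_mul_boundary hne
  obtain ⟨a, b, ha, hb, hab⟩ := exists_normSq_eq_of_mul_eq_normSq hp hq hdet
  refine ⟨a • x + b • y, fun i => ?_⟩
  rw [hermForm_smul_add_smul (hA i), ha, hb, hab, mul_assoc, Complex.re_ofReal_mul]
  linear_combination t * heq i

/-- The joint range of three Hermitian forms is convex. -/
theorem convex_range_hermForm {A : Fin 3 → Matrix ι ι ℂ} (hA : ∀ i, (A i).IsHermitian) :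
    Convex ℝ (Set.range fun x i => hermForm (A i) x) := by
  rintro _ ⟨x, rfl⟩ _ ⟨y, rfl⟩ r s hr hs -
  obtain ⟨z, hz⟩ := exists_hermForm_eq_add hA (((√r : ℝ) : ℂ) • x) (((√s : ℝ) : ℂ) • y)
  refine ⟨z, funext fun i => ?_⟩
  simp only [hz, hermForm_smul, Complex.normSq_ofReal, Real.mul_self_sqrt hr,
    Real.mul_self_sqrt hs, Pi.add_apply, Pi.smul_apply, smul_eq_mul]

end jointRange

/-- A linear function on `ℝ³` that is negative on the open octant `u < 0 < v, w` has
coefficients of the corresponding signs. -/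
theorem sign_of_neg_on_octant {c₀ c₁ c₂ : ℝ}
    (h : ∀ u v w : ℝ, 0 < u → 0 < v → 0 < w → -u * c₀ + v * c₁ + w * c₂ < 0) :
    0 ≤ c₀ ∧ c₁ ≤ 0 ∧ c₂ ≤ 0 := by
  have key : ∀ a d : ℝ, (∀ t : ℝ, 0 < t → t * a + d < 0) → a ≤ 0 := by
    intro a d had
    by_contra! ha
    have := had ((|d| + 1) / a) (by positivity)
    rw [div_mul_cancel₀ _ ha.ne'] at this
    linarith [neg_abs_le d]
  refine ⟨?_, key _ (-c₀ + c₂) fun t ht => ?_, key _ (-c₀ + c₁) fun t ht => ?_⟩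
  · linarith [key (-c₀) (c₁ + c₂) fun t ht => by linarith [h t 1 1 ht one_pos one_pos]]
  · linarith [h 1 t 1 one_pos ht one_pos]
  · linarith [h 1 1 t one_pos one_pos ht]

/-- Yakubovich: the S-procedure with two complex Hermitian form constraints is
lossless. -/
theorem sProcedure_complex_lossless_two {n : ℕ}
    (A₀ A₁ A₂ : Matrix (Fin n) (Fin n) ℂ)
    (h₀ : A₀.IsHermitian) (h₁ : A₁.IsHermitian) (h₂ : A₂.IsHermitian)
    (x₀ : Fin n → ℂ)
    (hs₁ : 0 < (star x₀ ⬝ᵥ A₁.mulVec x₀).re)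
    (hs₂ : 0 < (star x₀ ⬝ᵥ A₂.mulVec x₀).re)
    (himp : ∀ x : Fin n → ℂ,
      0 ≤ (star x ⬝ᵥ A₁.mulVec x).re → 0 ≤ (star x ⬝ᵥ A₂.mulVec x).re →
      0 ≤ (star x ⬝ᵥ A₀.mulVec x).re) :
    ∃ τ₁ τ₂ : ℝ, 0 ≤ τ₁ ∧ 0 ≤ τ₂ ∧
      ∀ x : Fin n → ℂ,
        0 ≤ (star x ⬝ᵥ A₀.mulVec x).re - τ₁ * (star x ⬝ᵥ A₁.mulVec x).re
              - τ₂ * (star x ⬝ᵥ A₂.mulVec x).re := by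
  have hA : ∀ i, ((![A₀, A₁, A₂] : Fin 3 → Matrix (Fin n) (Fin n) ℂ) i).IsHermitian := by
    intro i
    fin_cases i <;> assumption
  let S : Fin 3 → Set ℝ := ![Set.Iio 0, Set.Ioi 0, Set.Ioi 0]
  have hSconv : Convex ℝ (Set.univ.pi S) := convex_pi fun i _ => by
    fin_cases i
    exacts [convex_Iio 0, convex_Ioi 0, convex_Ioi 0]
  have hSopen : IsOpen (Set.univ.pi S) := isOpen_set_pi Set.finite_univ fun i _ => by
    fin_cases i
    exacts [isOpen_Iio, isOpen_Ioi, isOpen_Ioi]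
  have hdisj : Disjoint (Set.univ.pi S)
      (Set.range fun x i => hermForm ((![A₀, A₁, A₂] : Fin 3 → _) i) x) := by
    rw [Set.disjoint_left]
    rintro _ hmem ⟨x, rfl⟩
    have m0 : hermForm A₀ x < 0 := hmem 0 trivial
    have m1 : 0 < hermForm A₁ x := hmem 1 trivial
    have m2 : 0 < hermForm A₂ x := hmem 2 trivial
    exact m0.not_ge (himp x m1.le m2.le)
  obtain ⟨f, s, hfS, hfR⟩ :=
    geometric_hahn_banach_open hSconv hSopen (convex_range_hermForm hA) hdisj
  obtain ⟨c, hc⟩ : ∃ c : Fin 3 → ℝ, ∀ v, f v = v 0 * c 0 + v 1 * c 1 + v 2 * c 2 := by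
    refine ⟨fun i => f (Pi.single i 1), fun v => ?_⟩
    conv_lhs => rw [pi_eq_sum_univ' v]
    simp [Fin.sum_univ_three]
  have hR : ∀ x, s ≤ hermForm A₀ x * c 0 + hermForm A₁ x * c 1 + hermForm A₂ x * c 2 := by
    intro x
    have := hfR _ ⟨x, rfl⟩
    rwa [hc] at this
  have hs0 : s ≤ 0 := by simpa [hermForm] using hR 0
  have hneg : ∀ u v w : ℝ, 0 < u → 0 < v → 0 < w → -u * c 0 + v * c 1 + w * c 2 < 0 := by
    intro u v w hu hv hw
    have := hfS ![-u, v, w] fun i _ => by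
      fin_cases i
      exacts [neg_lt_zero.mpr hu, hv, hw]
    rw [hc] at this
    exact this.trans_le hs0
  obtain ⟨hc0, hc1, hc2⟩ := sign_of_neg_on_octant hneg
  have hnonneg : ∀ x, 0 ≤ hermForm A₀ x * c 0 + hermForm A₁ x * c 1 + hermForm A₂ x * c 2 := by
    intro x
    by_contra! hlt
    set d := hermForm A₀ x * c 0 + hermForm A₁ x * c 1 + hermForm A₂ x * c 2 with hd
    have hr : 0 ≤ (s - 1) / d := div_nonneg_of_nonpos (by linarith) hlt.le
    have := hR (((√((s - 1) / d) : ℝ) : ℂ) • x)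
    simp only [hermForm_smul, Complex.normSq_ofReal, Real.mul_self_sqrt hr] at this
    have e : (s - 1) / d * d = s - 1 := div_mul_cancel₀ _ hlt.ne
    rw [hd] at e
    linarith
  have hc0' : 0 < c 0 := by
    refine hc0.lt_of_ne fun h => ?_
    have hx := hnonneg x₀
    have hn := hneg 1 _ _ one_pos hs₁ hs₂
    simp only [← h, hermForm] at hx hn
    linarith
  refine ⟨-c 1 / c 0, -c 2 / c 0, div_nonneg (by linarith) hc0, div_nonneg (by linarith) hc0,
    fun x => ?_⟩
  have e : hermForm A₀ x - -c 1 / c 0 * hermForm A₁ x - -c 2 / c 0 * hermForm A₂ x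
      = (hermForm A₀ x * c 0 + hermForm A₁ x * c 1 + hermForm A₂ x * c 2) / c 0 := by
    field_simp
    ring
  exact (div_nonneg (hnonneg x) hc0).trans_eq e.symm
end

section
/- Let A_0, A_1 be n×n real symmetric matrices, b_0, b_1 ∈ ℝⁿ, c_0, c_1 ∈ ℝ, and define the quadratic functions F(x) = xᵀA_0x + 2b_0ᵀx + c_0 and G(x) = xᵀA_1x + 2b_1ᵀx + c_1. Suppose there exists x_0 ∈ ℝⁿ with G(x_0) > 0, and suppose F(x) ≥ 0 for every x ∈ ℝⁿ with G(x) ≥ 0. Then there exists a real number τ ≥ 0 such that F(x) − τG(x) ≥ 0 for all x ∈ ℝⁿ. -/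
open Matrix BigOperators

/-- A quadratic form restricted to the affine line `u + t v` is a quadratic polynomial in `t`. -/
lemma QuadraticMap.map_add_smul_eq {V : Type*} [AddCommGroup V] [Module ℝ V]
    (q : QuadraticForm ℝ V) (u v : V) (t : ℝ) :
    q (u + t • v) = q u + t * QuadraticMap.polar q u v + t ^ 2 * q v := by
  rw [QuadraticMap.map_add q, QuadraticMap.polar_smul_right, QuadraticMap.map_smul]
  simp only [smul_eq_mul]
  ring

/-- A quadratic polynomial with negative value at `0` and positive leading coefficient has two
roots of opposite signs. -/
lemma exists_neg_pos_roots_of_quadratic {a b c : ℝ} (ha : 0 < a) (hc : c < 0) :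
    ∃ r s : ℝ, r < 0 ∧ 0 < s ∧ c + r * b + r ^ 2 * a = 0 ∧ c + s * b + s ^ 2 * a = 0 ∧
      a * (r * s) = c := by
  have hd : b ^ 2 < b ^ 2 - 4 * a * c := by nlinarith [mul_pos ha (neg_pos.2 hc)]
  set d := √(b ^ 2 - 4 * a * c)
  have hsq : d ^ 2 = b ^ 2 - 4 * a * c := Real.sq_sqrt (by nlinarith [sq_nonneg b])
  have habs : |b| < d := Real.lt_sqrt_of_sq_lt (by rwa [sq_abs])
  obtain ⟨hb₁, hb₂⟩ := abs_lt.1 habs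
  refine ⟨(-b - d) / (2 * a), (-b + d) / (2 * a), div_neg_of_neg_of_pos (by linarith) (by linarith),
    div_pos (by linarith) (by linarith), ?_, ?_, ?_⟩ <;> field_simp <;> linarith

/-- The homogeneous S-lemma for quadratic forms on a real vector space. -/
theorem QuadraticForm.exists_nonneg_sub_mul_of_nonneg_imp {V : Type*} [AddCommGroup V] [Module ℝ V]
    (f g : QuadraticForm ℝ V) (hpos : ∃ v, 0 < g v) (himp : ∀ v, 0 ≤ g v → 0 ≤ f v) :
    ∃ τ : ℝ, 0 ≤ τ ∧ ∀ v, 0 ≤ f v - τ * g v := by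
  have key : ∀ u v, g u < 0 → 0 < g v → f u / g u ≤ f v / g v := by
    intro u v hu hv
    obtain ⟨r, s, hr, hs, hgr, hgs, hrs⟩ :=
      exists_neg_pos_roots_of_quadratic (b := QuadraticMap.polar g u v) hv hu
    have hfr := himp (u + r • v) (by rw [QuadraticMap.map_add_smul_eq, hgr])
    have hfs := himp (u + s • v) (by rw [QuadraticMap.map_add_smul_eq, hgs])
    rw [QuadraticMap.map_add_smul_eq] at hfr hfs
    have hcomb : 0 ≤ (s - r) * (f u - f v * (r * s)) := by
      nlinarith [mul_nonneg hs.le hfr, mul_nonneg (neg_nonneg.2 hr.le) hfs]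
    have hle := nonneg_of_mul_nonneg_right hcomb (by linarith)
    rw [div_le_iff_of_neg hu, div_mul_eq_mul_div, div_le_iff₀ hv, ← hrs]
    nlinarith [mul_nonneg hle hv.le]
  let S : Set ℝ := (fun v => f v / g v) '' {v | 0 < g v}
  have hne : S.Nonempty := Set.Nonempty.image _ hpos
  have hnonneg : ∀ y ∈ S, 0 ≤ y := by
    rintro _ ⟨v, hv, rfl⟩
    exact div_nonneg (himp v (le_of_lt hv)) (le_of_lt hv)
  refine ⟨sInf S, le_csInf hne hnonneg, fun v => ?_⟩
  rcases lt_trichotomy (g v) 0 with hv | hv | hv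
  · have : f v / g v ≤ sInf S := le_csInf hne (by rintro _ ⟨w, hw, rfl⟩; exact key v w hv hw)
    rw [div_le_iff_of_neg hv] at this
    linarith
  · simpa [hv] using himp v hv.ge
  · have : sInf S ≤ f v / g v := csInf_le ⟨0, hnonneg⟩ ⟨v, hv, rfl⟩
    rw [le_div_iff₀ hv] at this
    linarith

/-- If a quadratic polynomial is nonnegative on `[0, ∞)`, its leading coefficient is
nonnegative. -/
lemma leadingCoeff_nonneg_of_quadratic_nonneg {a b c : ℝ}
    (h : ∀ t : ℝ, 0 ≤ t → 0 ≤ c + t * b + t ^ 2 * a) : 0 ≤ a := by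
  by_contra! ha
  have ht : 0 ≤ (|b| + |c| + 1) / -a + 1 :=
    add_nonneg (div_nonneg (by positivity) (by linarith)) zero_le_one
  have hmul : ((|b| + |c| + 1) / -a + 1) * a = a - (|b| + |c| + 1) := by
    rw [add_mul, div_neg, neg_mul, div_mul_cancel₀ _ ha.ne]
    ring
  have ht1 : 1 ≤ (|b| + |c| + 1) / -a + 1 := by
    linarith [div_nonneg (show 0 ≤ |b| + |c| + 1 by positivity) (neg_nonneg.2 ha.le)]
  have := h _ ht
  generalize (|b| + |c| + 1) / -a + 1 = t at *
  nlinarith [le_abs_self b, le_abs_self c, abs_nonneg c,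
    mul_nonneg ht (sub_nonneg.2 (le_abs_self b)),
    mul_nonneg (sub_nonneg.2 ht1) (abs_nonneg c), mul_nonneg ht (neg_nonneg.2 ha.le)]

/-- The homogenization `(x, t) ↦ xᵀAx + 2t bᵀx + ct²` of a quadratic function. -/
noncomputable def homogenizedQuadraticForm {n : ℕ} (A : Matrix (Fin n) (Fin n) ℝ)
    (b : Fin n → ℝ) (c : ℝ) : QuadraticForm ℝ (Fin n ⊕ Unit → ℝ) :=
  (fromBlocks A (replicateCol Unit b) (replicateRow Unit b) (of fun _ _ => c)).toQuadraticForm'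

lemma homogenizedQuadraticForm_apply {n : ℕ} (A : Matrix (Fin n) (Fin n) ℝ)
    (b : Fin n → ℝ) (c : ℝ) (x : Fin n → ℝ) (t : ℝ) :
    homogenizedQuadraticForm A b c (Sum.elim x fun _ => t) =
      x ⬝ᵥ A *ᵥ x + 2 * t * (b ⬝ᵥ x) + c * t ^ 2 := by
  have hcol : x ⬝ᵥ replicateCol Unit b *ᵥ (fun _ => t) = t * (b ⬝ᵥ x) := by
    simp only [dotProduct, mulVec, replicateCol_apply, Finset.univ_unique, Finset.sum_singleton,
      Finset.mul_sum]
    exact Finset.sum_congr rfl fun i _ => by ring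
  have hrow : (fun _ : Unit => t) ⬝ᵥ replicateRow Unit b *ᵥ x = t * (b ⬝ᵥ x) := by
    simp [dotProduct, mulVec]
  have hconst : (fun _ : Unit => t) ⬝ᵥ (of fun _ _ => c : Matrix Unit Unit ℝ) *ᵥ (fun _ => t) =
      c * t ^ 2 := by
    simp only [dotProduct, mulVec, of_apply, Finset.univ_unique, Finset.sum_singleton]
    ring
  rw [homogenizedQuadraticForm, Matrix.toQuadraticForm', LinearMap.BilinMap.toQuadraticMap_apply,
    Matrix.toLinearMap₂'_apply', fromBlocks_mulVec, sumElim_dotProduct_sumElim]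
  simp only [Sum.elim_comp_inl, Sum.elim_comp_inr, dotProduct_add, hcol, hrow, hconst]
  ring

/-- The classical S-lemma: for real quadratic functions `F` and `G`, if
`G(x₀) > 0` for some `x₀` and `F(x) ≥ 0` whenever `G(x) ≥ 0`, then there is
`τ ≥ 0` with `F(x) − τ G(x) ≥ 0` for all `x`. -/
theorem sLemma_real {n : ℕ} (A₀ A₁ : Matrix (Fin n) (Fin n) ℝ)
    (hA₀ : A₀.IsSymm) (hA₁ : A₁.IsSymm)
    (b₀ b₁ : Fin n → ℝ) (c₀ c₁ : ℝ) (x₀ : Fin n → ℝ)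
    (hs : 0 < x₀ ⬝ᵥ A₁.mulVec x₀ + 2 * (b₁ ⬝ᵥ x₀) + c₁)
    (himp : ∀ x : Fin n → ℝ,
      0 ≤ x ⬝ᵥ A₁.mulVec x + 2 * (b₁ ⬝ᵥ x) + c₁ →
      0 ≤ x ⬝ᵥ A₀.mulVec x + 2 * (b₀ ⬝ᵥ x) + c₀) :
    ∃ τ : ℝ, 0 ≤ τ ∧ ∀ x : Fin n → ℝ,
      0 ≤ (x ⬝ᵥ A₀.mulVec x + 2 * (b₀ ⬝ᵥ x) + c₀)
            - τ * (x ⬝ᵥ A₁.mulVec x + 2 * (b₁ ⬝ᵥ x) + c₁) := by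
  set f := homogenizedQuadraticForm A₀ b₀ c₀ with hf
  set g := homogenizedQuadraticForm A₁ b₁ c₁ with hg
  let lift : (Fin n → ℝ) → Fin n ⊕ Unit → ℝ := fun x => Sum.elim x fun _ => 1
  have hf_lift : ∀ x, f (lift x) = x ⬝ᵥ A₀ *ᵥ x + 2 * (b₀ ⬝ᵥ x) + c₀ := fun x => by
    simp [hf, lift, homogenizedQuadraticForm_apply]
  have hg_lift : ∀ x, g (lift x) = x ⬝ᵥ A₁ *ᵥ x + 2 * (b₁ ⬝ᵥ x) + c₁ := fun x => by
    simp [hg, lift, homogenizedQuadraticForm_apply]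
  simp only [← hf_lift, ← hg_lift] at hs himp ⊢
  -- At infinity: move from `x₀` in whichever of the directions `± v` keeps `g` nonnegative.
  have hray : ∀ x, 0 ≤ QuadraticMap.polar g (lift x₀) (Sum.elim x fun _ => 0) →
      0 ≤ g (Sum.elim x fun _ => 0) → 0 ≤ f (Sum.elim x fun _ => 0) := by
    intro x hpolar hx
    refine leadingCoeff_nonneg_of_quadratic_nonneg
      (b := QuadraticMap.polar f (lift x₀) (Sum.elim x fun _ => 0)) (c := f (lift x₀))
      fun t ht => ?_
    have hline : lift (x₀ + t • x) = lift x₀ + t • Sum.elim x fun _ => 0 := by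
      ext (i | i) <;> simp [lift]
    rw [← QuadraticMap.map_add_smul_eq, ← hline]
    apply himp
    rw [hline, QuadraticMap.map_add_smul_eq]
    positivity
  have hhom : ∀ v, 0 ≤ g v → 0 ≤ f v := by
    intro v hv
    obtain ⟨x, t, rfl⟩ : ∃ (x : Fin n → ℝ) (t : ℝ), v = Sum.elim x fun _ => t :=
      ⟨v ∘ Sum.inl, v (Sum.inr ()), by ext (i | i) <;> rfl⟩
    rcases eq_or_ne t 0 with rfl | ht
    · rcases le_total 0 (QuadraticMap.polar g (lift x₀) (Sum.elim x fun _ => 0)) with h | h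
      · exact hray x h hv
      · have hneg : (Sum.elim (-x) fun _ => 0 : Fin n ⊕ Unit → ℝ) = -Sum.elim x fun _ => 0 := by
          ext (i | i) <;> simp
        have := hray (-x)
        rw [hneg, QuadraticMap.polar_neg_right, QuadraticMap.map_neg, QuadraticMap.map_neg] at this
        exact this (neg_nonneg.2 h) hv
    · have hscale : (Sum.elim x fun _ => t) = t • lift (t⁻¹ • x) := by
        ext (i | i) <;> simp [lift, ht]
      have htt : 0 < t * t := mul_self_pos.2 ht
      rw [hscale, QuadraticMap.map_smul, smul_eq_mul] at hv ⊢
      exact mul_nonneg htt.le (himp _ (nonneg_of_mul_nonneg_right hv htt))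
  obtain ⟨τ, hτ, h⟩ := f.exists_nonneg_sub_mul_of_nonneg_imp g ⟨_, hs⟩ hhom
  exact ⟨τ, hτ, fun x => h _⟩
end
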